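/- Let N ≥ 2, s ∈ (0,1), μ ≥ μ_0, and let Ω ⊂ ℝ^N be a bounded C² domain with 0 ∈ Ω. Let f ∈ C^θ_loc(cl(Ω)∖{0}) for some θ ∈ (0,1) be nonnegative with ∫_Ω f Γ_μ dx = +∞. Then there exists no nonnegative function u ∈ L^∞_loc(ℝ^N∖{0}) ∩ L¹(ℝ^N, dx/(1+|x|^{N+2s})) such that u ≥ 0 on ℝ^N∖Ω and ∫_{ℝ^N} u (−Δ)^s φ dx + μ ∫_{ℝ^N} u φ |x|^{−2s} dx = ∫_Ω f φ dx for all φ ∈ C^∞_c(Ω∖{0}). -/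

import Mathlib

open MeasureTheory Filter Set Topology Metric

noncomputable section

/-- Euclidean space `ℝ^N`. -/
abbrev EN (N : ℕ) := EuclideanSpace ℝ (Fin N)

/-- The normalizing constant `C_{N,s}` of the fractional Laplacian. -/
def CNs (N : ℕ) (s : ℝ) : ℝ :=
  2 ^ (2*s) * Real.pi ^ (-(N:ℝ)/2) * s * Real.Gamma ((N + 2*s)/2) / Real.Gamma (1 - s)

/-- The optimal fractional Hardy constant `μ₀`. -/
def mu0 (N : ℕ) (s : ℝ) : ℝ :=
  -(2 ^ (2*s) * Real.Gamma ((N + 2*s)/4) ^ 2 / Real.Gamma ((N - 2*s)/4) ^ 2)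

/-- The function `τ ↦ c_s(τ)`. -/
def csFun (N : ℕ) (s τ : ℝ) : ℝ :=
  2 ^ (2*s) * Real.Gamma ((N + τ)/2) * Real.Gamma ((2*s - τ)/2) /
    (Real.Gamma (-τ/2) * Real.Gamma ((N - 2*s + τ)/2))

/-- `u` has fractional Laplacian `(-Δ)^s u (x) = L` at `x`, as a principal value. -/
def HasFracLap (N : ℕ) (s : ℝ) (u : EN N → ℝ) (x : EN N) (L : ℝ) : Prop :=
  Tendsto (fun ε : ℝ =>
      CNs N s * ∫ z in {z : EN N | ε ≤ dist x z}, (u x - u z) / dist x z ^ ((N:ℝ) + 2*s))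
    (𝓝[>] 0) (𝓝 L)

/-- `v` has weighted fractional Laplacian `(-Δ)^s_{Γ_μ} v (x) = L` at `x`, where the weight
is `Γ_μ(z) = ‖z‖ ^ τp` with `τp = τ₊(s,μ)`. -/
def HasWFracLap (N : ℕ) (s τp : ℝ) (v : EN N → ℝ) (x : EN N) (L : ℝ) : Prop :=
  Tendsto (fun ε : ℝ =>
      CNs N s * ∫ z in {z : EN N | ε ≤ dist x z},
        (v x - v z) * ‖z‖ ^ τp / dist x z ^ ((N:ℝ) + 2*s))
    (𝓝[>] 0) (𝓝 L)

/-- Membership in `L¹(ℝ^N, dx/(1+|x|^{N+2s}))`. -/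
def MemL1w (N : ℕ) (s : ℝ) (u : EN N → ℝ) : Prop :=
  Integrable (fun x : EN N => u x / (1 + ‖x‖ ^ ((N:ℝ) + 2*s)))

/-- Membership in `L^∞_loc(ℝ^N \ {0})`. -/
def LocBddAway (N : ℕ) (u : EN N → ℝ) : Prop :=
  ∀ K : Set (EN N), IsCompact K → (0:EN N) ∉ K → ∃ C : ℝ, ∀ x ∈ K, |u x| ≤ C

/-- Local `θ`-Hölder continuity on compact subsets of `S`, i.e. `C^θ_loc(S)`. -/
def HolderLocOn (N : ℕ) (θ : ℝ) (f : EN N → ℝ) (S : Set (EN N)) : Prop :=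
  ∀ K ⊆ S, IsCompact K → ∃ C : ℝ, ∀ x ∈ K, ∀ y ∈ K, |f x - f y| ≤ C * dist x y ^ θ

/-- Membership in `L^∞_loc(S)`. -/
def LinfLocOn (N : ℕ) (f : EN N → ℝ) (S : Set (EN N)) : Prop :=
  AEMeasurable f ∧ ∀ K ⊆ S, IsCompact K → ∃ C : ℝ, ∀ x ∈ K, |f x| ≤ C

/-- A bounded `C²` domain: open, connected and bounded, whose boundary is the regular zero
level set of a `C²` defining function. -/
structure IsBoundedC2Domain (N : ℕ) (Ω : Set (EN N)) : Prop where
  isOpen : IsOpen Ω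
  isConnected : IsConnected Ω
  isBounded : Bornology.IsBounded Ω
  c2Boundary : ∃ φ : EN N → ℝ, ContDiff ℝ 2 φ ∧ Ω = {x | φ x < 0} ∧
    ∀ x ∈ frontier Ω, fderiv ℝ φ x ≠ 0

/-- A bounded domain: open, connected and bounded. -/
def IsBoundedDomain (N : ℕ) (Ω : Set (EN N)) : Prop :=
  IsOpen Ω ∧ IsConnected Ω ∧ Bornology.IsBounded Ω

/-- The first standard coordinate vector `e₁ ∈ ℝ^N`. -/
def e1 (N : ℕ) : EN N :=
  (EuclideanSpace.equiv (Fin N) ℝ).symm (fun i => if (i:ℕ) = 0 then 1 else 0)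

/-- The surface measure `ω_{N-1}` of the unit sphere in `ℝ^N`. -/
def omegaN (N : ℕ) : ℝ := N * (volume (ball (0 : EN N) 1)).toReal

/-- The normalization constant `c_{s,0}`. -/
def cs0 (N : ℕ) (s : ℝ) : ℝ :=
  CNs N s * omegaN N * ∫ t in Ioo (0:ℝ) 1, ∫ z in ball (0:EN N) t,
    (‖z‖ ^ (2*s - N) - 1) / ‖e1 N - z‖ ^ ((N:ℝ) + 2*s)

/-- The fundamental solution `Φ_μ`, expressed via the exponent `τ = τ₋(s,μ)`:
`Φ_μ(x) = |x|^τ` for `μ ≠ μ₀` and `Φ_{μ₀}(x) = -|x|^τ ln |x|`. -/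
def Phi (N : ℕ) (s μ τ : ℝ) (x : EN N) : ℝ :=
  if μ = mu0 N s then -(‖x‖ ^ τ * Real.log ‖x‖) else ‖x‖ ^ τ

/-- The integrand appearing in the definition of `c_{s,μ}`. -/
def cIntegrand (N : ℕ) (s μ τm τp : ℝ) (z : EN N) : ℝ :=
  if μ = mu0 N s then ‖z‖ ^ ((2*s - N)/2) * (-Real.log ‖z‖) / ‖e1 N - z‖ ^ ((N:ℝ) + 2*s)
  else (‖z‖ ^ τm - ‖z‖ ^ τp) / ‖e1 N - z‖ ^ ((N:ℝ) + 2*s)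

/-- The normalization constant `c_{s,μ}`. -/
def csmu (N : ℕ) (s μ τm τp : ℝ) : ℝ :=
  CNs N s * omegaN N * ∫ t in Ioo (0:ℝ) 1, ∫ z in ball (0:EN N) t, cIntegrand N s μ τm τp z

/-- The weight `Λ_μ`, expressed via `τp = τ₊(s,μ)`. -/
def Lam (N : ℕ) (s τp : ℝ) (x : EN N) : ℝ :=
  if 2*s - 1 < τp then 1
  else if τp < 2*s - 1 then ‖x‖ ^ (1 - 2*s + τp)
  else 1 + max (-Real.log ‖x‖) 0

/-- The quadratic form `E^s(u,v)`. -/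
def Es (N : ℕ) (s : ℝ) (u v : EN N → ℝ) : ℝ :=
  (CNs N s / 2) *
    ∫ p : EN N × EN N, (u p.1 - u p.2) * (v p.1 - v p.2) / dist p.1 p.2 ^ ((N:ℝ) + 2*s)

/-- The quadratic form `E^s_μ(u,v)`. -/
def Esmu (N : ℕ) (s μ : ℝ) (u v : EN N → ℝ) : ℝ :=
  Es N s u v + μ * ∫ x : EN N, u x * v x / ‖x‖ ^ (2*s)

/-- `E^s_{A,B}(u,u) < ∞`. -/
def FiniteEnergyOn (N : ℕ) (s : ℝ) (u : EN N → ℝ) (A B : Set (EN N)) : Prop :=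
  IntegrableOn (fun p : EN N × EN N => (u p.1 - u p.2)^2 / dist p.1 p.2 ^ ((N:ℝ) + 2*s)) (A ×ˢ B)

/-- Membership in `H^s(ℝ^N)`: locally `L²` with finite Gagliardo seminorm. -/
def MemHs (N : ℕ) (s : ℝ) (u : EN N → ℝ) : Prop :=
  (∀ K : Set (EN N), IsCompact K → IntegrableOn (fun x => (u x)^2) K) ∧
  FiniteEnergyOn N s u univ univ

/-- Membership in `H^s_0(Ω)`. -/
def MemHs0 (N : ℕ) (s : ℝ) (Ω : Set (EN N)) (u : EN N → ℝ) : Prop :=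
  MemHs N s u ∧ ∀ᵐ x : EN N, x ∉ Ω → u x = 0

/-- Membership in `W^s(Ω)`. -/
def MemWs (N : ℕ) (s : ℝ) (Ω : Set (EN N)) (u : EN N → ℝ) : Prop :=
  MemL1w N s u ∧ IntegrableOn (fun x => (u x)^2) Ω ∧
  ∃ Ω' : Set (EN N), IsOpen Ω' ∧ IsConnected Ω' ∧ closure Ω ⊆ Ω' ∧ FiniteEnergyOn N s u Ω Ω'

/-- Membership in `W^s_*(Ω)`. -/
def MemWsStar (N : ℕ) (s : ℝ) (Ω : Set (EN N)) (u : EN N → ℝ) : Prop :=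
  MemL1w N s u ∧ ∀ ε : ℝ, 0 < ε → MemWs N s (Ω \ closedBall 0 ε) u

/-- The distributional identity `L^s_μ u = f` in `Ω \ {0}`, tested against `C^∞_c(Ω\{0})`. -/
def DistrEq (N : ℕ) (s μ : ℝ) (Ω : Set (EN N)) (f u : EN N → ℝ) : Prop :=
  ∀ φ : EN N → ℝ, ContDiff ℝ (⊤ : ℕ∞) φ → HasCompactSupport φ → tsupport φ ⊆ Ω \ {0} →
    ∀ g : EN N → ℝ, (∀ x, HasFracLap N s φ x (g x)) →
      (∫ x, u x * g x) + μ * ∫ x, u x * φ x / ‖x‖ ^ (2*s) = ∫ x in Ω, f x * φ x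

/-- A distributional solution of `L^s_μ u = f` in `Ω \ {0}` with `u = 0` in `ℝ^N \ Ω`. -/
def IsDistrSol (N : ℕ) (s μ : ℝ) (Ω : Set (EN N)) (f u : EN N → ℝ) : Prop :=
  LocBddAway N u ∧ MemL1w N s u ∧ (∀ x ∉ Ω, u x = 0) ∧ DistrEq N s μ Ω f u

lemma gam_int {a r : ℝ} (ha : 0 < a) (hr : 0 < r) :
    IntegrableOn (fun t : ℝ => t ^ (a-1) * Real.exp (-(r*t))) (Ioi 0) := by
  have := integrableOn_rpow_mul_exp_neg_mul_rpow (p := 1) (s := a-1) (b := r) (by linarith)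
    one_pos hr
  simpa [neg_mul] using this

lemma gam_val {a r : ℝ} (ha : 0 < a) (hr : 0 < r) :
    ∫ t in Ioi (0:ℝ), t ^ (a-1) * Real.exp (-(r*t)) = r ^ (-a) * Real.Gamma a := by
  rw [Real.integral_rpow_mul_exp_neg_mul_Ioi ha hr, one_div, Real.inv_rpow hr.le,
    Real.rpow_neg hr.le]

lemma exp_diff_bound {X Z t : ℝ} (hX : 0 < X) (hZ : 0 < Z) (ht : 0 < t) :
    |Real.exp (-(X*t)) - Real.exp (-(Z*t))| ≤ |X - Z| * t * Real.exp (-(min X Z * t)) := by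
  wlog h : X ≤ Z generalizing X Z
  · have := this hZ hX (le_of_not_ge h)
    rw [abs_sub_comm, abs_sub_comm X Z, min_comm]; exact this
  rw [min_eq_left h, abs_of_nonneg, abs_sub_comm, abs_of_nonneg (by linarith)]
  · have h1 := Real.add_one_le_exp (-((Z-X)*t))
    have h2 : Real.exp (-(Z*t)) = Real.exp (-(X*t)) * Real.exp (-((Z-X)*t)) := by
      rw [← Real.exp_add]; ring_nf
    rw [h2]
    nlinarith [Real.exp_pos (-(X*t))]
  · rw [sub_nonneg]; apply Real.exp_le_exp.2; nlinarith

lemma powdiff_int {b X Z : ℝ} (hb : b < 1) (hX : 0 < X) (hZ : 0 < Z) :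
    IntegrableOn (fun t : ℝ => t ^ (-b-1) * (Real.exp (-(X*t)) - Real.exp (-(Z*t)))) (Ioi 0) := by
  have h1 := (gam_int (a := 1-b) (r := min X Z) (by linarith) (lt_min hX hZ)).const_mul |X-Z|
  refine Integrable.mono' h1 ?_ ?_
  · apply Measurable.aestronglyMeasurable; fun_prop
  · filter_upwards [ae_restrict_mem measurableSet_Ioi] with t ht
    have ht : 0 < t := ht
    rw [norm_mul, Real.norm_eq_abs, Real.norm_eq_abs, abs_of_pos (Real.rpow_pos_of_pos ht _)]
    have := mul_le_mul_of_nonneg_left (exp_diff_bound hX hZ ht)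
      (Real.rpow_pos_of_pos ht (-b-1)).le
    refine this.trans (le_of_eq ?_)
    have h3 : t ^ (1 - b - 1) = t ^ (-b-1) * t := by
      rw [← Real.rpow_add_one ht.ne']; ring_nf
    rw [h3]; ring

lemma powdiff_val {b X Z : ℝ} (hb : b < 1) (hb0 : b ≠ 0) (hX : 0 < X) (hZ : 0 < Z) :
    ∫ t in Ioi (0:ℝ), t ^ (-b-1) * (Real.exp (-(X*t)) - Real.exp (-(Z*t)))
      = Real.Gamma (-b) * (X ^ b - Z ^ b) := by
  let F : ℝ → ℝ := fun t => t ^ (-b) * (Real.exp (-(X*t)) - Real.exp (-(Z*t)))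
  let B : ℝ → ℝ := fun t => X * (t ^ ((1-b)-1) * Real.exp (-(X*t)))
      - Z * (t ^ ((1-b)-1) * Real.exp (-(Z*t)))
  have hBint : IntegrableOn B (Ioi 0) :=
    ((gam_int (a := 1-b) (by linarith) hX).const_mul X).sub
      ((gam_int (a := 1-b) (by linarith) hZ).const_mul Z)
  have hAint := powdiff_int hb hX hZ
  have hBval : ∫ t in Ioi (0:ℝ), B t = Real.Gamma (1-b) * (X^b - Z^b) := by
    simp only [B]
    rw [integral_sub ((gam_int (a := 1-b) (by linarith) hX).const_mul X)
      ((gam_int (a := 1-b) (by linarith) hZ).const_mul Z), integral_const_mul,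
      integral_const_mul, gam_val (by linarith) hX, gam_val (by linarith) hZ]
    have e : ∀ Y : ℝ, 0 < Y → Y * Y ^ (-(1-b)) = Y ^ b := fun Y hY => by
      rw [mul_comm, ← Real.rpow_add_one hY.ne']; ring_nf
    rw [← mul_assoc, ← mul_assoc, e X hX, e Z hZ]; ring
  have hderiv : ∀ t ∈ Ioi (0:ℝ), HasDerivAt F
      (-b * (t ^ (-b-1) * (Real.exp (-(X*t)) - Real.exp (-(Z*t)))) - B t) t := by
    intro t ht
    have ht : 0 < t := ht
    have e : ∀ Y : ℝ, HasDerivAt (fun t => Real.exp (-(Y*t))) (Real.exp (-(Y*t)) * (-(Y*1))) t :=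
      fun Y => (((hasDerivAt_id t).const_mul Y).neg).exp
    have := (Real.hasDerivAt_rpow_const (x := t) (p := -b) (Or.inl ht.ne')).mul ((e X).sub (e Z))
    convert! this using 1
    simp only [B, Pi.sub_apply]
    have h3 : t ^ (1 - b - 1) = t ^ (-b) := by ring_nf
    rw [h3]; ring
  have hF0 : F 0 = 0 := by simp [F]
  have hbd : ∀ t ∈ Ioi (0:ℝ), |F t| ≤ |X-Z| * (t ^ (1-b) * Real.exp (-(min X Z) * t)) := by
    intro t ht
    have ht : 0 < t := ht
    simp only [F]
    rw [abs_mul, abs_of_pos (Real.rpow_pos_of_pos ht _)]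
    have := mul_le_mul_of_nonneg_left (exp_diff_bound hX hZ ht)
      (Real.rpow_pos_of_pos ht (-b)).le
    refine this.trans (le_of_eq ?_)
    have h3 : t ^ (1 - b) = t ^ (-b) * t := by
      rw [← Real.rpow_add_one ht.ne']; ring_nf
    rw [h3]; ring_nf
  have hcont : ContinuousWithinAt F (Ici 0) 0 := by
    rw [← continuousWithinAt_Ioi_iff_Ici]
    unfold ContinuousWithinAt
    rw [hF0]
    have hc : Tendsto (fun t : ℝ => |X-Z| * (t ^ (1-b) * Real.exp (-(min X Z) * t))) (𝓝[>] 0)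
        (𝓝 0) := by
      have : Continuous (fun t : ℝ => |X-Z| * (t ^ (1-b) * Real.exp (-(min X Z) * t))) := by
        have := Real.continuous_rpow_const (q := 1-b) (by linarith)
        fun_prop
      have h := (this.tendsto 0).mono_left (nhdsWithin_le_nhds (s := Ioi 0))
      simpa [Real.zero_rpow (show 1-b ≠ 0 by linarith)] using h
    refine squeeze_zero_norm' ?_ hc
    filter_upwards [self_mem_nhdsWithin] with t ht using hbd t ht
  have hlim : Tendsto F atTop (𝓝 0) := by
    have hc := (tendsto_rpow_mul_exp_neg_mul_atTop_nhds_zero (1-b) (min X Z)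
      (lt_min hX hZ)).const_mul |X-Z|
    rw [mul_zero] at hc
    refine squeeze_zero_norm' ?_ hc
    filter_upwards [eventually_gt_atTop 0] with t ht using hbd t ht
  have key := integral_Ioi_of_hasDerivAt_of_tendsto hcont hderiv
    ((hAint.const_mul (-b)).sub hBint) hlim
  rw [integral_sub (hAint.const_mul (-b)) hBint, integral_const_mul, hBval, hF0] at key
  have hG : Real.Gamma (1-b) = -b * Real.Gamma (-b) := by
    rw [← Real.Gamma_add_one (neg_ne_zero.2 hb0)]; ring_nf
  rw [hG] at key
  have : -b * ((∫ t in Ioi (0:ℝ), t ^ (-b-1) * (Real.exp (-(X*t)) - Real.exp (-(Z*t))))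
      - Real.Gamma (-b) * (X ^ b - Z ^ b)) = 0 := by linarith
  rcases mul_eq_zero.1 this with h | h
  · exact absurd h (neg_ne_zero.2 hb0)
  · linarith

lemma beta_inf {s p : ℝ} (hs1 : s < 1) (hp : 0 < p + s) :
    IntegrableOn (fun j : ℝ => j ^ (-s) * (1+j) ^ (-p-1)) (Ioi 0) ∧
    Real.Gamma (p+1) * ∫ j in Ioi (0:ℝ), j ^ (-s) * (1+j) ^ (-p-1)
      = Real.Gamma (1-s) * Real.Gamma (p+s) := by
  have hp1 : 0 < p + 1 := by linarith
  let k : ℝ → ℝ → ℝ := fun j m => j ^ (-s) * (m ^ p * Real.exp (-((1+j)*m)))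
  have hmeas : Measurable (Function.uncurry k) := by
    simp only [k, Function.uncurry_def]; fun_prop
  have inner_j : ∀ m : ℝ, 0 < m → IntegrableOn (fun j => k j m) (Ioi 0) ∧
      ∫ j in Ioi (0:ℝ), k j m = Real.Gamma (1-s) * (m ^ ((p+s)-1) * Real.exp (-(1*m))) := by
    intro m hm
    have e : (fun j => k j m) = fun j => (m ^ p * Real.exp (-m)) *
        (j ^ ((1-s)-1) * Real.exp (-(m*j))) := by
      funext j; simp only [k]
      rw [show -((1+j)*m) = -m + -(m*j) by ring, Real.exp_add]; ring_nf
    rw [e]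
    refine ⟨(gam_int (by linarith) hm).const_mul _, ?_⟩
    rw [integral_const_mul, gam_val (by linarith) hm,
      show p + s - 1 = p + -(1-s) by ring, Real.rpow_add hm]
    ring_nf
  have inner_m : ∀ j : ℝ, 0 < j → 
      ∫ m in Ioi (0:ℝ), k j m = Real.Gamma (p+1) * (j ^ (-s) * (1+j) ^ (-p-1)) := by
    intro j hj
    simp only [k]
    have := gam_val hp1 (show 0 < 1 + j by linarith)
    rw [add_sub_cancel_right] at this
    rw [integral_const_mul, this]; ring_nf
  have hInteg : Integrable (Function.uncurry k)
      ((volume.restrict (Ioi (0:ℝ))).prod (volume.restrict (Ioi (0:ℝ)))) := by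
    rw [integrable_prod_iff' hmeas.aestronglyMeasurable]
    constructor
    · filter_upwards [ae_restrict_mem measurableSet_Ioi] with m hm using (inner_j m hm).1
    · refine ((gam_int (a := p+s) hp one_pos).const_mul (Real.Gamma (1-s))).congr ?_
      filter_upwards [ae_restrict_mem measurableSet_Ioi] with m hm
      rw [← (inner_j m hm).2]
      refine setIntegral_congr_fun measurableSet_Ioi fun j hj => ?_
      have hj : 0 < j := hj
      have hm : 0 < m := hm
      simp only [Function.uncurry, k]
      rw [Real.norm_of_nonneg]; positivity
  have hsw := integral_integral_swap hInteg
  have h1 : ∫ j in Ioi (0:ℝ), ∫ m in Ioi (0:ℝ), k j m =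
      Real.Gamma (p+1) * ∫ j in Ioi (0:ℝ), j ^ (-s) * (1+j) ^ (-p-1) := by
    rw [← integral_const_mul]
    exact setIntegral_congr_fun measurableSet_Ioi fun j hj => inner_m j hj
  have h2 : ∫ m in Ioi (0:ℝ), ∫ j in Ioi (0:ℝ), k j m =
      Real.Gamma (1-s) * Real.Gamma (p+s) := by
    rw [setIntegral_congr_fun measurableSet_Ioi fun m hm => (inner_j m hm).2,
      integral_const_mul, gam_val hp one_pos]; simp
  refine ⟨?_, by rw [← h1, hsw, h2]⟩
  have h3 := hInteg.integral_prod_left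
  have h4 : IntegrableOn (fun j : ℝ => Real.Gamma (p+1) * (j ^ (-s) * (1+j) ^ (-p-1))) (Ioi 0) := by
    refine h3.congr ?_
    filter_upwards [ae_restrict_mem measurableSet_Ioi] with j hj using inner_m j hj
  have h5 := h4.const_mul (Real.Gamma (p+1))⁻¹
  refine h5.congr (Eventually.of_forall fun j => ?_)
  have := (Real.Gamma_pos_of_pos hp1).ne'
  simp only; field_simp

lemma J_bound {p j : ℝ} (hp : -1 < p) (hj : 0 < j) : |1 - (1+j) ^ (-p)| ≤ |p| * j := by
  rcases le_or_gt 0 p with h | h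
  · have h1 : (1+j) ^ (-p) ≤ 1 :=
      Real.rpow_le_one_of_one_le_of_nonpos (by linarith) (by linarith)
    rw [abs_of_nonneg (by linarith), abs_of_nonneg h, Real.rpow_def_of_pos (by linarith)]
    have h2 := Real.add_one_le_exp (Real.log (1+j) * -p)
    have h3 := Real.log_le_sub_one_of_pos (show 0 < 1+j by linarith)
    nlinarith
  · have h1 : 1 ≤ (1+j) ^ (-p) := Real.one_le_rpow (by linarith) (by linarith)
    rw [abs_of_nonpos (by linarith), abs_of_neg h]
    have := rpow_one_add_le_one_add_mul_self (s := j) (by linarith) (p := -p) (by linarith)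
      (by linarith)
    linarith

lemma J_bound2 {p j : ℝ} (hp : -1 < p) (hj : 1 ≤ j) : |1 - (1+j) ^ (-p)| ≤ 2 + 2 * j ^ (-p) := by
  have h0 : 0 < j := by linarith
  have hj0 : 0 < j ^ (-p) := Real.rpow_pos_of_pos h0 _
  have hp0 : 0 < (1+j) ^ (-p) := by positivity
  suffices (1+j) ^ (-p) ≤ 1 + 2 * j ^ (-p) by rw [abs_le]; constructor <;> linarith
  rcases le_or_gt 0 p with h | h
  · have h1 : (1+j) ^ (-p) ≤ 1 :=
      Real.rpow_le_one_of_one_le_of_nonpos (by linarith) (by linarith)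
    linarith
  · have h1 : (1+j) ^ (-p) ≤ (2*j)^(-p) :=
      Real.rpow_le_rpow (by linarith) (by linarith) (by linarith)
    rw [Real.mul_rpow (by norm_num) h0.le] at h1
    have h2 : (2:ℝ) ^ (-p) ≤ 2 ^ (1:ℝ) :=
      Real.rpow_le_rpow_of_exponent_le (by norm_num) (by linarith)
    rw [Real.rpow_one] at h2
    nlinarith

lemma J_int {s p : ℝ} (hs0 : 0 < s) (hs1 : s < 1) (hp : 0 < p + s) :
    IntegrableOn (fun j : ℝ => j ^ (-1-s) * (1 - (1+j) ^ (-p))) (Ioi 0) := by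
  rw [← Ioc_union_Ioi_eq_Ioi (show (0:ℝ) ≤ 1 by norm_num)]
  have hm : Measurable (fun j : ℝ => j ^ (-1-s) * (1 - (1+j) ^ (-p))) := by fun_prop
  refine IntegrableOn.union ?_ ?_
  · have h1 : IntegrableOn (fun j : ℝ => |p| * j ^ (-s)) (Ioc 0 1) := by
      have := (intervalIntegral.intervalIntegrable_rpow' (a := 0) (b := 1) (r := -s)
        (by linarith)).const_mul |p|
      rwa [intervalIntegrable_iff_integrableOn_Ioc_of_le (by norm_num)] at this
    refine Integrable.mono' h1 hm.aestronglyMeasurable ?_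
    filter_upwards [ae_restrict_mem measurableSet_Ioc] with j hj
    rw [norm_mul, Real.norm_eq_abs, Real.norm_eq_abs, abs_of_pos (Real.rpow_pos_of_pos hj.1 _)]
    have := mul_le_mul_of_nonneg_left (J_bound (p := p) (by linarith) hj.1)
      (Real.rpow_pos_of_pos hj.1 (-1-s)).le
    refine this.trans (le_of_eq ?_)
    rw [show -s = (-1-s)+1 by ring, Real.rpow_add_one hj.1.ne']; ring
  · have h1 : IntegrableOn (fun j : ℝ => 2 * j ^ (-1-s) + 2 * j ^ (-1-s-p)) (Ioi 1) :=
      (((integrableOn_Ioi_rpow_iff one_pos).2 (by linarith)).const_mul 2).add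
        (((integrableOn_Ioi_rpow_iff one_pos).2 (by linarith)).const_mul 2)
    refine Integrable.mono' h1 hm.aestronglyMeasurable ?_
    filter_upwards [ae_restrict_mem measurableSet_Ioi] with j hj
    have hj : 1 < j := hj
    have hj0 : 0 < j := by linarith
    rw [norm_mul, Real.norm_eq_abs, Real.norm_eq_abs, abs_of_pos (Real.rpow_pos_of_pos hj0 _)]
    have := mul_le_mul_of_nonneg_left (J_bound2 (p := p) (by linarith) hj.le)
      (Real.rpow_pos_of_pos hj0 (-1-s)).le
    refine this.trans (le_of_eq ?_)
    rw [show -1-s-p = (-1-s)+-p by ring, Real.rpow_add hj0]; ring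

lemma J_val {s p : ℝ} (hs0 : 0 < s) (hs1 : s < 1) (hp : 0 < p + s) :
    s * ∫ j in Ioi (0:ℝ), j ^ (-1-s) * (1 - (1+j) ^ (-p))
      = Real.Gamma (1-s) * Real.Gamma (p+s) / Real.Gamma p := by
  obtain ⟨hBint, hBval⟩ := beta_inf hs1 hp
  have hAint := J_int hs0 hs1 hp
  let F : ℝ → ℝ := fun j => j ^ (-s) * ((1+j) ^ (-p) - 1)
  have hF0 : F 0 = 0 := by simp [F]
  have hderiv : ∀ j ∈ Ioi (0:ℝ), HasDerivAt F
      (s * (j ^ (-1-s) * (1 - (1+j) ^ (-p))) - p * (j ^ (-s) * (1+j) ^ (-p-1))) j := by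
    intro j hj
    have hj : 0 < j := hj
    have h1 := Real.hasDerivAt_rpow_const (x := j) (p := -s) (Or.inl hj.ne')
    have h2 : HasDerivAt (fun j : ℝ => (1+j) ^ (-p) - 1) (1 * -p * (1+j)^(-p-1)) j :=
      (((hasDerivAt_id j).const_add 1).rpow_const (p := -p)
        (Or.inl (by simp; linarith))).sub_const 1
    convert! h1.mul h2 using 1
    rw [show -s-1 = -1-s by ring]; ring
  have hcont : ContinuousWithinAt F (Ici 0) 0 := by
    rw [← continuousWithinAt_Ioi_iff_Ici]
    unfold ContinuousWithinAt
    rw [hF0]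
    have hc : Tendsto (fun t : ℝ => |p| * t ^ (1-s)) (𝓝[>] 0) (𝓝 0) := by
      have : Continuous (fun t : ℝ => |p| * t ^ (1-s)) := by
        have := Real.continuous_rpow_const (q := 1-s) (by linarith)
        fun_prop
      have h := (this.tendsto 0).mono_left (nhdsWithin_le_nhds (s := Ioi 0))
      simpa [Real.zero_rpow (show 1-s ≠ 0 by linarith)] using h
    refine squeeze_zero_norm' ?_ hc
    filter_upwards [self_mem_nhdsWithin] with j hj
    have hj : 0 < j := hj
    simp only [F]
    rw [norm_mul, Real.norm_eq_abs, Real.norm_eq_abs, abs_of_pos (Real.rpow_pos_of_pos hj _),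
      abs_sub_comm]
    refine (mul_le_mul_of_nonneg_left (J_bound (p := p) (by linarith) hj)
      (Real.rpow_pos_of_pos hj (-s)).le).trans (le_of_eq ?_)
    rw [show 1-s = -s + 1 by ring, Real.rpow_add_one hj.ne']; ring
  have hlim : Tendsto F atTop (𝓝 0) := by
    have h1 := (tendsto_rpow_neg_atTop hs0).const_mul 2
    have h2 := (tendsto_rpow_neg_atTop hp).const_mul 2
    have hc := h1.add h2
    simp only [mul_zero, add_zero] at hc
    refine squeeze_zero_norm' ?_ hc
    filter_upwards [eventually_ge_atTop 1] with j hj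
    have hj0 : 0 < j := by linarith
    simp only [F]
    rw [norm_mul, Real.norm_eq_abs, Real.norm_eq_abs, abs_of_pos (Real.rpow_pos_of_pos hj0 _),
      abs_sub_comm]
    refine (mul_le_mul_of_nonneg_left (J_bound2 (p := p) (by linarith) hj)
      (Real.rpow_pos_of_pos hj0 (-s)).le).trans (le_of_eq ?_)
    rw [show -(p+s) = -s + -p by ring, Real.rpow_add hj0]; ring
  have key := integral_Ioi_of_hasDerivAt_of_tendsto hcont hderiv
    ((hAint.const_mul s).sub (hBint.const_mul p)) hlim
  rw [integral_sub (hAint.const_mul s) (hBint.const_mul p), integral_const_mul,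
    integral_const_mul, hF0] at key
  have key2 : s * ∫ j in Ioi (0:ℝ), j ^ (-1-s) * (1 - (1+j) ^ (-p)) =
    p * ∫ j in Ioi (0:ℝ), j ^ (-s) * (1+j) ^ (-p-1) := by linarith
  rw [key2]
  by_cases hp0 : p = 0
  · simp [hp0]
  · have hG1 : Real.Gamma (p+1) ≠ 0 := (Real.Gamma_pos_of_pos (by linarith)).ne'
    have hGe := Real.Gamma_add_one hp0
    have hG : Real.Gamma p ≠ 0 := by
      intro h; rw [h, mul_zero] at hGe; exact hG1 hGe
    rw [← hBval, hGe]; field_simp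

/-- Gaussian average of the increments of `φ` at `x`. -/
def Dh (N : ℕ) (φ : EN N → ℝ) (x : EN N) (l : ℝ) : ℝ :=
  ∫ z : EN N, (φ x - φ z) * Real.exp (-(l * ‖x - z‖ ^ 2))

lemma radial_int {N : ℕ} (hN : 2 ≤ N) (F : ℝ → ℝ)
    (h : IntegrableOn (fun r : ℝ => r ^ ((N:ℝ) - 1) * F r) (Ioi 0)) :
    Integrable (fun z : EN N => F ‖z‖) := by
  have : Nonempty (Fin N) := ⟨⟨0, by omega⟩⟩
  rw [integrable_fun_norm_addHaar]
  refine h.congr ?_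
  filter_upwards with r
  rw [finrank_euclideanSpace_fin, smul_eq_mul, ← Real.rpow_natCast, Nat.cast_sub (by omega),
    Nat.cast_one]

lemma pow_gauss_int {N : ℕ} (hN : 2 ≤ N) {σ l : ℝ} (hσ : -(N:ℝ) < σ) (hl : 0 < l) (x : EN N) :
    Integrable (fun z : EN N => ‖z‖ ^ σ * Real.exp (-(l * ‖x - z‖ ^ 2))) := by
  have h1 : Integrable (fun z : EN N => ‖z‖ ^ σ * Real.exp (-(l/2) * ‖z‖ ^ 2)) := by
    refine radial_int hN (fun r => r ^ σ * Real.exp (-(l/2) * r ^ 2)) ?_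
    have := integrableOn_rpow_mul_exp_neg_mul_sq (b := l/2) (by linarith)
      (s := (N:ℝ) - 1 + σ) (by linarith)
    refine this.congr ?_
    filter_upwards [ae_restrict_mem measurableSet_Ioi] with r hr
    rw [Real.rpow_add hr, mul_assoc]
  refine Integrable.mono' (h1.const_mul (Real.exp (l * ‖x‖^2))) ?_ ?_
  · apply Measurable.aestronglyMeasurable; fun_prop
  · filter_upwards with z
    rw [Real.norm_of_nonneg (by positivity)]
    have h2 : ‖z‖ ^ 2 ≤ 2 * ‖x - z‖ ^ 2 + 2 * ‖x‖ ^ 2 := by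
      have : ‖z‖ ≤ ‖x - z‖ + ‖x‖ := by
        have := norm_sub_norm_le z x
        rw [norm_sub_rev] at this; linarith
      nlinarith [norm_nonneg z, norm_nonneg (x - z), norm_nonneg x, sq_nonneg (‖x-z‖ - ‖x‖)]
    have h3 : Real.exp (-(l * ‖x - z‖ ^ 2)) ≤
        Real.exp (l * ‖x‖^2) * Real.exp (-(l/2) * ‖z‖ ^ 2) := by
      rw [← Real.exp_add]; apply Real.exp_le_exp.2; nlinarith
    have := mul_le_mul_of_nonneg_left h3 (show 0 ≤ ‖z‖ ^ σ by positivity)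
    linarith

lemma gauss_int {N : ℕ} (hN : 2 ≤ N) {l : ℝ} (hl : 0 < l) (x : EN N) :
    Integrable (fun z : EN N => Real.exp (-(l * ‖x - z‖ ^ 2))) := by
  have := pow_gauss_int hN (σ := 0) (by simp; omega) hl x
  simpa using this

lemma gauss_val {N : ℕ} {l : ℝ} (hl : 0 < l) (x : EN N) :
    ∫ z : EN N, Real.exp (-(l * ‖x - z‖ ^ 2)) = (Real.pi / l) ^ ((N:ℝ)/2) := by
  have := GaussianFourier.integral_rexp_neg_mul_sq_norm (V := EN N) hl
  rw [finrank_euclideanSpace_fin] at this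
  rw [← this, ← integral_sub_left_eq_self (fun z : EN N => Real.exp (-l * ‖z‖ ^ 2)) volume x]
  simp [neg_mul]

lemma gauss2_val {N : ℕ} {l j : ℝ} (hl : 0 < l) (hj : 0 < j) (x : EN N) :
    ∫ z : EN N, Real.exp (-(l * ‖z‖^2 * j)) * Real.exp (-(l * ‖x - z‖ ^ 2)) =
      (Real.pi / l) ^ ((N:ℝ)/2) * ((1+j) ^ (-((N:ℝ)/2)) *
        Real.exp (-(l * (‖x‖^2 * (j / (1+j)))))) := by
  have hj1 : 0 < 1 + j := by linarith
  have e : ∀ z : EN N, Real.exp (-(l * ‖z‖^2 * j)) * Real.exp (-(l * ‖x - z‖ ^ 2)) =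
      Real.exp (-(l * (‖x‖^2 * (j / (1+j))))) *
        Real.exp (-(l * (1+j) * ‖(1+j)⁻¹ • x - z‖ ^ 2)) := by
    intro z
    rw [← Real.exp_add, ← Real.exp_add]
    congr 1
    rw [norm_sub_sq_real, norm_sub_sq_real, norm_smul, inner_smul_left, Real.norm_of_nonneg (by positivity)]
    simp only [map_inv₀, conj_trivial]
    field_simp; ring
  simp_rw [e]
  rw [integral_const_mul, gauss_val (by positivity), ← div_div, Real.div_rpow (by positivity) hj1.le,
    Real.rpow_neg hj1.le]
  ring

lemma Dh_pow {N : ℕ} (hN : 2 ≤ N) {σ l : ℝ} (hσ : -(N:ℝ) < σ) (hσ2 : σ < 2) (hσ0 : σ ≠ 0)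
    (hl : 0 < l) (x : EN N) (hx : x ≠ 0) :
    Real.Gamma (-(σ/2)) * l ^ (σ/2) * Dh N (fun z => ‖z‖ ^ σ) x l =
      (Real.pi / l) ^ ((N:ℝ)/2) * ∫ j in Ioi (0:ℝ), j ^ (-(σ/2)-1) *
        (Real.exp (-(j * ‖x‖^2 * l)) - (1+j) ^ (-((N:ℝ)/2)) *
          Real.exp (-((j * ‖x‖^2 / (1+j)) * l))) := by
  set b := σ/2 with hb
  have hb1 : b < 1 := by rw [hb]; linarith
  have hb0 : b ≠ 0 := by rw [hb]; exact div_ne_zero hσ0 two_ne_zero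
  have hX : 0 < ‖x‖ := norm_pos_iff.2 hx
  have hsq : ∀ z : EN N, z ≠ 0 → (‖z‖^2) ^ b = ‖z‖ ^ σ := by
    intro z hz
    rw [← Real.rpow_natCast, ← Real.rpow_mul (norm_nonneg z), hb]; congr 1; push_cast; ring
  let k : EN N → ℝ → ℝ := fun z j => j ^ (-b-1) * (Real.exp (-(l * ‖x‖^2 * j)) -
      Real.exp (-(l * ‖z‖^2 * j))) * Real.exp (-(l * ‖x - z‖ ^ 2))
  have hmeas : Measurable (Function.uncurry k) := by
    simp only [k, Function.uncurry_def]; fun_prop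
  have hae : ∀ᵐ z : EN N, z ≠ 0 := by
    have : Nonempty (Fin N) := ⟨⟨0, by omega⟩⟩
    simp [ae_iff, measure_singleton]
  have inner_j : ∀ z : EN N, z ≠ 0 → IntegrableOn (k z) (Ioi 0) ∧
      ∫ j in Ioi (0:ℝ), k z j = Real.Gamma (-b) * l ^ b *
        ((‖x‖ ^ σ - ‖z‖ ^ σ) * Real.exp (-(l * ‖x - z‖ ^ 2))) := by
    intro z hz
    have hz' : 0 < ‖z‖ := norm_pos_iff.2 hz
    refine ⟨(powdiff_int hb1 (by positivity) (by positivity)).mul_const _, ?_⟩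
    simp only [k]
    rw [integral_mul_const, powdiff_val hb1 hb0 (by positivity) (by positivity),
      Real.mul_rpow hl.le (by positivity), Real.mul_rpow hl.le (by positivity), hsq x hx, hsq z hz]
    ring
  have hDint : Integrable (fun z : EN N => (‖x‖ ^ σ - ‖z‖ ^ σ) * Real.exp (-(l * ‖x - z‖ ^ 2))) := by
    simp_rw [sub_mul]
    exact ((gauss_int hN hl x).const_mul _).sub (pow_gauss_int hN hσ hl x)
  have hInteg : Integrable (Function.uncurry k)
      ((volume : Measure (EN N)).prod (volume.restrict (Ioi (0:ℝ)))) := by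
    rw [integrable_prod_iff hmeas.aestronglyMeasurable]
    constructor
    · filter_upwards [hae] with z hz using (inner_j z hz).1
    · refine (hDint.const_mul (Real.Gamma (-b) * l ^ b)).norm.congr ?_
      filter_upwards [hae] with z hz
      rw [← (inner_j z hz).2]
      rcases le_total ‖x‖ ‖z‖ with h | h
      · have hs : ∀ j ∈ Ioi (0:ℝ), ‖Function.uncurry k (z, j)‖ = k z j := by
          intro j hj
          have hj : 0 < j := hj
          simp only [Function.uncurry]
          rw [Real.norm_of_nonneg]
          refine mul_nonneg (mul_nonneg (by positivity) ?_) (by positivity)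
          rw [sub_nonneg]; apply Real.exp_le_exp.2; gcongr
        rw [setIntegral_congr_fun measurableSet_Ioi hs, Real.norm_of_nonneg]
        refine setIntegral_nonneg measurableSet_Ioi fun j hj => ?_
        rw [← hs j hj]; positivity
      · have hs : ∀ j ∈ Ioi (0:ℝ), ‖Function.uncurry k (z, j)‖ = - k z j := by
          intro j hj
          have hj : 0 < j := hj
          simp only [Function.uncurry]
          rw [Real.norm_of_nonpos]
          refine mul_nonpos_of_nonpos_of_nonneg
            (mul_nonpos_of_nonneg_of_nonpos (by positivity) ?_) (by positivity)
          rw [sub_nonpos]; apply Real.exp_le_exp.2; gcongr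
        rw [setIntegral_congr_fun measurableSet_Ioi hs, integral_neg, Real.norm_of_nonpos]
        refine setIntegral_nonpos measurableSet_Ioi fun j hj => ?_
        have := hs j hj
        have h2 := norm_nonneg (Function.uncurry k (z, j))
        linarith
  have hsw := integral_integral_swap hInteg
  have h1 : ∫ z : EN N, ∫ j in Ioi (0:ℝ), k z j =
      Real.Gamma (-b) * l ^ b * Dh N (fun z => ‖z‖ ^ σ) x l := by
    unfold Dh
    rw [← integral_const_mul]
    refine integral_congr_ae ?_
    filter_upwards [hae] with z hz using (inner_j z hz).2
  rw [← h1, hsw, ← integral_const_mul]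
  refine setIntegral_congr_fun measurableSet_Ioi fun j hj => ?_
  have hj : 0 < j := hj
  simp only [k]
  simp_rw [mul_assoc (j ^ (-b-1))]
  have hi2 : Integrable (fun z : EN N => Real.exp (-(l * ‖z‖^2 * j)) *
      Real.exp (-(l * ‖x - z‖ ^ 2))) := by
    refine Integrable.mono' (gauss_int hN hl x) ?_ ?_
    · apply Measurable.aestronglyMeasurable; fun_prop
    · filter_upwards with z
      rw [Real.norm_of_nonneg (by positivity)]
      have : Real.exp (-(l * ‖z‖^2 * j)) ≤ 1 := by
        rw [Real.exp_le_one_iff]; have : 0 ≤ l * ‖z‖^2 * j := by positivity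
        linarith
      nlinarith [Real.exp_pos (-(l * ‖x - z‖ ^ 2))]
  simp_rw [sub_mul]
  rw [integral_const_mul, integral_sub ((gauss_int hN hl x).const_mul _) hi2, integral_const_mul,
    gauss_val hl, gauss2_val hl hj]
  rw [show l * ‖x‖^2 * j = j * ‖x‖^2 * l by ring,
    show l * (‖x‖^2 * (j / (1+j))) = j * ‖x‖^2 / (1+j) * l by ring]
  ring

lemma pow_double {n s b X : ℝ} (hn : 0 < n) (hs0 : 0 < s) (hs1 : s < 1) (hbs : b < s)
    (hnb : 0 < n + b) (hX : 0 < X) :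
    let k : ℝ → ℝ → ℝ := fun l j => l ^ ((s-b)-1) * (j ^ (-b-1) *
        (Real.exp (-(j * X * l)) - (1+j) ^ (-n) * Real.exp (-((j * X / (1+j)) * l))))
    IntegrableOn (fun l => ∫ j in Ioi (0:ℝ), k l j) (Ioi 0) ∧
    s * ∫ l in Ioi (0:ℝ), ∫ j in Ioi (0:ℝ), k l j =
      Real.Gamma (s-b) * X ^ (b-s) *
        (Real.Gamma (1-s) * Real.Gamma (n+b) / Real.Gamma (n+b-s)) := by
  intro k
  have hsb : 0 < s - b := by linarith
  let k1 : ℝ → ℝ → ℝ := fun l j => (j ^ (-b-1) * (1 - (1+j) ^ (-n))) *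
    (l ^ ((s-b)-1) * Real.exp (-(j * X * l)))
  let k2 : ℝ → ℝ → ℝ := fun l j => (j ^ (-b-1) * (1+j) ^ (-n)) *
    (l ^ ((s-b)-1) * Real.exp (-(j * X * l)) - l ^ ((s-b)-1) * Real.exp (-((j * X / (1+j)) * l)))
  have hk : k = fun l j => k1 l j + k2 l j := by
    funext l j; simp only [k, k1, k2]; ring
  have hm1 : Measurable (Function.uncurry k1) := by
    simp only [k1, Function.uncurry_def]; fun_prop
  have hm2 : Measurable (Function.uncurry k2) := by
    simp only [k2, Function.uncurry_def]; fun_prop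
  have hpow : ∀ j : ℝ, 0 < j → j ^ (-b-1) * (j * X) ^ (-(s-b)) = X ^ (b-s) * j ^ (-1-s) := by
    intro j hj
    rw [Real.mul_rpow hj.le hX.le, ← mul_assoc, ← Real.rpow_add hj]
    ring_nf
  have in1 : ∀ j : ℝ, 0 < j → IntegrableOn (fun l => k1 l j) (Ioi 0) ∧
      ∫ l in Ioi (0:ℝ), k1 l j =
        Real.Gamma (s-b) * X ^ (b-s) * (j ^ (-1-s) * (1 - (1+j) ^ (-n))) := by
    intro j hj
    have hjX : 0 < j * X := by positivity
    refine ⟨(gam_int hsb hjX).const_mul _, ?_⟩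
    simp only [k1]
    rw [integral_const_mul, gam_val hsb hjX]
    linear_combination (1 - (1+j) ^ (-n)) * Real.Gamma (s-b) * hpow j hj
  have in2 : ∀ j : ℝ, 0 < j → IntegrableOn (fun l => k2 l j) (Ioi 0) ∧
      ∫ l in Ioi (0:ℝ), k2 l j =
        Real.Gamma (s-b) * X ^ (b-s) * (j ^ (-1-s) * (1 - (1+j) ^ (-(n+b-s)))
          - j ^ (-1-s) * (1 - (1+j) ^ (-n))) := by
    intro j hj
    have hj1 : 0 < 1 + j := by linarith
    have hjX : 0 < j * X := by positivity
    have hjX2 : 0 < j * X / (1+j) := by positivity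
    have i1 := gam_int hsb hjX
    have i2 := gam_int hsb hjX2
    refine ⟨(i1.sub i2).const_mul _, ?_⟩
    simp only [k2]
    rw [integral_const_mul, integral_sub i1 i2, gam_val hsb hjX, gam_val hsb hjX2,
      Real.div_rpow hjX.le hj1.le]
    have e1 : (1+j) ^ (-(n+b-s)) = (1+j) ^ (-n) * (1+j) ^ (s-b) := by
      rw [← Real.rpow_add hj1]; ring_nf
    rw [e1, Real.rpow_neg hj1.le (s-b), div_inv_eq_mul]
    linear_combination ((1+j) ^ (-n) * (1 - (1+j) ^ (s-b))) * Real.Gamma (s-b) * hpow j hj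
  have J1 := J_int hs0 hs1 (show 0 < n + s by linarith)
  have J2 := J_int hs0 hs1 (show 0 < (n + b - s) + s by linarith)
  have hi1 : Integrable (Function.uncurry k1)
      ((volume.restrict (Ioi (0:ℝ))).prod (volume.restrict (Ioi (0:ℝ)))) := by
    rw [integrable_prod_iff' hm1.aestronglyMeasurable]
    constructor
    · filter_upwards [ae_restrict_mem measurableSet_Ioi] with j hj using (in1 j hj).1
    · refine (J1.const_mul (Real.Gamma (s-b) * X ^ (b-s))).congr ?_
      filter_upwards [ae_restrict_mem measurableSet_Ioi] with j hj
      rw [← (in1 j hj).2]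
      refine setIntegral_congr_fun measurableSet_Ioi fun l hl => ?_
      have hj : 0 < j := hj
      have hl : 0 < l := hl
      simp only [Function.uncurry, k1]
      rw [Real.norm_of_nonneg]
      have : (1+j) ^ (-n) ≤ 1 :=
        Real.rpow_le_one_of_one_le_of_nonpos (by linarith) (by linarith)
      exact mul_nonneg (mul_nonneg (by positivity) (by linarith)) (by positivity)
  have hi2 : Integrable (Function.uncurry k2)
      ((volume.restrict (Ioi (0:ℝ))).prod (volume.restrict (Ioi (0:ℝ)))) := by
    rw [integrable_prod_iff' hm2.aestronglyMeasurable]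
    constructor
    · filter_upwards [ae_restrict_mem measurableSet_Ioi] with j hj using (in2 j hj).1
    · refine (((J2.sub J1).const_mul (Real.Gamma (s-b) * X ^ (b-s))).neg).congr ?_
      filter_upwards [ae_restrict_mem measurableSet_Ioi] with j hj
      simp only [Pi.neg_apply, Pi.sub_apply]
      rw [← (in2 j hj).2, ← integral_neg]
      refine setIntegral_congr_fun measurableSet_Ioi fun l hl => ?_
      have hj : 0 < j := hj
      have hl : 0 < l := hl
      simp only [Function.uncurry, k2]
      rw [Real.norm_of_nonpos]
      refine mul_nonpos_of_nonneg_of_nonpos (by positivity) ?_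
      rw [← mul_sub]
      refine mul_nonpos_of_nonneg_of_nonpos (by positivity) ?_
      rw [sub_nonpos]; apply Real.exp_le_exp.2
      have : j * X / (1+j) ≤ j * X := div_le_self (by positivity) (by linarith)
      nlinarith
  have hi : Integrable (Function.uncurry k)
      ((volume.restrict (Ioi (0:ℝ))).prod (volume.restrict (Ioi (0:ℝ)))) := by
    rw [hk]; exact hi1.add hi2
  refine ⟨hi.integral_prod_left, ?_⟩
  rw [integral_integral_swap hi]
  have : ∫ j in Ioi (0:ℝ), ∫ l in Ioi (0:ℝ), k l j =
      Real.Gamma (s-b) * X ^ (b-s) * ∫ j in Ioi (0:ℝ), (j ^ (-1-s) * (1 - (1+j) ^ (-(n+b-s)))) := by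
    rw [← integral_const_mul]
    refine setIntegral_congr_fun measurableSet_Ioi fun j hj => ?_
    simp only [hk]
    rw [integral_add (in1 j hj).1 (in2 j hj).1, (in1 j hj).2, (in2 j hj).2]; ring
  rw [this]
  have hv := J_val hs0 hs1 (show 0 < (n + b - s) + s by linarith)
  rw [show n + b - s + s = n + b by ring] at hv
  rw [← hv]; ring

/-- The subordination constant. -/
def kap (N : ℕ) (s : ℝ) : ℝ := CNs N s / Real.Gamma ((N:ℝ)/2 + s)

lemma pow_lap {N : ℕ} (hN : 2 ≤ N) {s σ : ℝ} (hs0 : 0 < s) (hs1 : s < 1)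
    (hσ : -(N:ℝ) < σ) (hσ2 : σ < 2*s) (x : EN N) (hx : x ≠ 0) :
    IntegrableOn (fun l : ℝ => l ^ ((N:ℝ)/2 + s - 1) * Dh N (fun z => ‖z‖ ^ σ) x l) (Ioi 0) ∧
    kap N s * ∫ l in Ioi (0:ℝ), l ^ ((N:ℝ)/2 + s - 1) * Dh N (fun z => ‖z‖ ^ σ) x l
      = csFun N s σ * (‖x‖ ^ σ * ‖x‖ ^ (-(2*s))) := by
  by_cases hσ0 : σ = 0
  · subst hσ0
    simp [Dh, csFun]
  have hX : 0 < ‖x‖ := norm_pos_iff.2 hx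
  have hN0 : (0:ℝ) < N := by exact_mod_cast (by omega : 0 < N)
  have hG : Real.Gamma (-(σ/2)) ≠ 0 := by
    apply Real.Gamma_ne_zero
    intro m hm
    rcases m with _ | m
    · apply hσ0; simp at hm; linarith
    · push_cast at hm
      have : (0:ℝ) ≤ m := Nat.cast_nonneg m
      linarith
  obtain ⟨hI, hv⟩ := pow_double (n := (N:ℝ)/2) (s := s) (b := σ/2) (X := ‖x‖^2) (by positivity)
    hs0 hs1 (by linarith) (by linarith) (by positivity)
  set K := fun l : ℝ => ∫ j in Ioi (0:ℝ), l ^ ((s-σ/2)-1) * (j ^ (-(σ/2)-1) *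
        (Real.exp (-(j * ‖x‖^2 * l)) - (1+j) ^ (-((N:ℝ)/2)) *
          Real.exp (-((j * ‖x‖^2 / (1+j)) * l)))) with hK
  have key : ∀ l ∈ Ioi (0:ℝ), l ^ ((N:ℝ)/2 + s - 1) * Dh N (fun z => ‖z‖ ^ σ) x l =
      ((Real.Gamma (-(σ/2)))⁻¹ * Real.pi ^ ((N:ℝ)/2)) * K l := by
    intro l hl
    have hl : 0 < l := hl
    have h1 := Dh_pow hN hσ (by linarith) hσ0 hl x hx
    simp only [hK]
    rw [integral_const_mul]
    rw [Real.div_rpow Real.pi_pos.le hl.le] at h1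
    have e : l ^ ((N:ℝ)/2 + s - 1) = l ^ ((s-σ/2)-1) * (l ^ (σ/2) * l ^ ((N:ℝ)/2)) := by
      rw [← Real.rpow_add hl, ← Real.rpow_add hl]; ring_nf
    rw [e]
    have hl1 : l ^ ((N:ℝ)/2) ≠ 0 := (Real.rpow_pos_of_pos hl _).ne'
    generalize (∫ j in Ioi (0:ℝ), j ^ (-(σ/2)-1) *
        (Real.exp (-(j * ‖x‖^2 * l)) - (1+j) ^ (-((N:ℝ)/2)) *
          Real.exp (-((j * ‖x‖^2 / (1+j)) * l)))) = I0 at h1 ⊢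
    field_simp at h1 ⊢
    linear_combination h1
  constructor
  · refine (hI.const_mul ((Real.Gamma (-(σ/2)))⁻¹ * Real.pi ^ ((N:ℝ)/2))).congr ?_
    filter_upwards [ae_restrict_mem measurableSet_Ioi] with l hl using (key l hl).symm
  · rw [setIntegral_congr_fun measurableSet_Ioi key, integral_const_mul]
    have hv' : s * ∫ l in Ioi (0:ℝ), K l = _ := hv
    have hG2 : Real.Gamma ((N:ℝ)/2 + s) ≠ 0 := (Real.Gamma_pos_of_pos (by positivity)).ne'
    have hG3 : Real.Gamma (1-s) ≠ 0 := (Real.Gamma_pos_of_pos (by linarith)).ne'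
    have hpi : Real.pi ^ (-(N:ℝ)/2) * Real.pi ^ ((N:ℝ)/2) = 1 := by
      rw [← Real.rpow_add Real.pi_pos]; ring_nf; simp
    have hXp : (‖x‖^2) ^ (σ/2 - s) = ‖x‖ ^ σ * ‖x‖ ^ (-(2*s)) := by
      rw [← Real.rpow_natCast, ← Real.rpow_mul (norm_nonneg x), ← Real.rpow_add hX]
      congr 1; push_cast; ring
    rw [hXp] at hv'
    unfold kap CNs csFun
    rw [show ((N:ℝ) + 2*s)/2 = (N:ℝ)/2 + s by ring, show ((N:ℝ)+σ)/2 = (N:ℝ)/2 + σ/2 by ring,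
      show (2*s-σ)/2 = s - σ/2 by ring, show -σ/2 = -(σ/2) by ring,
      show ((N:ℝ) - 2*s + σ)/2 = (N:ℝ)/2 + σ/2 - s by ring]
    generalize Real.Gamma ((N:ℝ)/2 + σ/2 - s) = G4 at *
    generalize (∫ l in Ioi (0:ℝ), K l) = I at *
    calc _ = (2 ^ (2*s) / Real.Gamma (1-s) / Real.Gamma (-(σ/2))) * 
          (Real.pi ^ (-(N:ℝ)/2) * Real.pi ^ ((N:ℝ)/2)) * (s * I) := by
            field_simp
      _ = _ := by
            rw [hpi, hv']; field_simp

lemma ae_ne {N : ℕ} (hN : 2 ≤ N) (x : EN N) : ∀ᵐ z : EN N, z ≠ x := by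
  have : Nonempty (Fin N) := ⟨⟨0, by omega⟩⟩
  simp [ae_iff, measure_singleton]

lemma lk {N : ℕ} (hN : 2 ≤ N) {s : ℝ} (hs0 : 0 < s) (Q : EN N → ℝ) (x : EN N)
    (hQm : AEStronglyMeasurable Q)
    (hQ : Integrable (fun z => Q z / ‖x - z‖ ^ ((N:ℝ) + 2*s))) :
    IntegrableOn (fun l : ℝ => l ^ ((N:ℝ)/2 + s - 1) * ∫ z, Q z * Real.exp (-(l * ‖x - z‖ ^ 2)))
      (Ioi 0) ∧
    ∫ l in Ioi (0:ℝ), l ^ ((N:ℝ)/2 + s - 1) * ∫ z, Q z * Real.exp (-(l * ‖x - z‖ ^ 2)) =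
      Real.Gamma ((N:ℝ)/2 + s) * ∫ z, Q z / ‖x - z‖ ^ ((N:ℝ) + 2*s) := by
  have ha : 0 < (N:ℝ)/2 + s := by positivity
  set a := (N:ℝ)/2 + s with hadef
  let F : ℝ → EN N → ℝ := fun l z => l ^ (a - 1) * (Q z * Real.exp (-(l * ‖x - z‖ ^ 2)))
  have hne : ∀ᵐ z : EN N, z ≠ x := ae_ne hN x
  have hpow : ∀ z : EN N, z ≠ x → 0 < ‖x - z‖ ^ 2 ∧
      (‖x - z‖ ^ 2) ^ (-a) = (‖x - z‖ ^ ((N:ℝ) + 2*s))⁻¹ := by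
    intro z hz
    have : 0 < ‖x - z‖ := norm_pos_iff.2 (sub_ne_zero.2 hz.symm)
    refine ⟨by positivity, ?_⟩
    rw [← Real.rpow_natCast, ← Real.rpow_mul this.le, ← Real.rpow_neg this.le]
    congr 1; push_cast; rw [hadef]; ring
  have hFm : AEStronglyMeasurable (Function.uncurry F)
      ((volume.restrict (Ioi (0:ℝ))).prod volume) := by
    refine AEStronglyMeasurable.mul ?_ (AEStronglyMeasurable.mul hQm.comp_snd ?_)
    · exact Measurable.aestronglyMeasurable (by fun_prop)
    · exact Measurable.aestronglyMeasurable (by fun_prop)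
  have hF1 : ∀ z : EN N, z ≠ x → IntegrableOn (fun l => F l z) (Ioi 0) := by
    intro z hz
    have := (gam_int ha (hpow z hz).1).const_mul (Q z)
    refine this.congr (Eventually.of_forall fun l => ?_)
    simp only [F]; ring_nf
  have hF2 : ∀ z : EN N, z ≠ x → ∀ c : ℝ, 
      ∫ l in Ioi (0:ℝ), l ^ (a - 1) * (c * Real.exp (-(l * ‖x - z‖ ^ 2)))
       = Real.Gamma a * (c / ‖x - z‖ ^ ((N:ℝ) + 2*s)) := by
    intro z hz c
    have := gam_val ha (hpow z hz).1
    rw [(hpow z hz).2] at this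
    rw [div_eq_mul_inv, mul_left_comm, mul_comm (Real.Gamma a), ← this, ← integral_const_mul]
    refine integral_congr_ae (Eventually.of_forall fun l => ?_)
    simp only; ring_nf
  have hFi : Integrable (Function.uncurry F) ((volume.restrict (Ioi (0:ℝ))).prod volume) := by
    rw [integrable_prod_iff' hFm]
    constructor
    · filter_upwards [hne] with z hz using hF1 z hz
    · refine ((hQ.norm).const_mul (Real.Gamma a)).congr ?_
      filter_upwards [hne] with z hz
      have h2 := hF2 z hz |Q z|
      rw [norm_div, Real.norm_eq_abs, Real.norm_of_nonneg (by positivity), ← h2]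
      refine setIntegral_congr_fun measurableSet_Ioi fun l hl => ?_
      have hl : 0 < l := hl
      simp only [Function.uncurry, F]
      rw [norm_mul, norm_mul, Real.norm_of_nonneg (by positivity : 0 ≤ l ^ (a-1)),
        Real.norm_of_nonneg (Real.exp_pos _).le, Real.norm_eq_abs]
  have hEq : ∀ l : ℝ, (∫ z, F l z) = l ^ (a - 1) * ∫ z, Q z * Real.exp (-(l * ‖x - z‖ ^ 2)) := by
    intro l; rw [← integral_const_mul]
  constructor
  · refine hFi.integral_prod_left.congr (Eventually.of_forall fun l => ?_)
    exact hEq l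
  · simp_rw [← hEq]
    rw [integral_integral_swap hFi, ← integral_const_mul]
    refine integral_congr_ae ?_
    filter_upwards [hne] with z hz
    exact hF2 z hz (Q z)

/-- second difference -/
def sdiff2 {N : ℕ} (φ : EN N → ℝ) (x y : EN N) : ℝ := 2 * φ x - φ (x + y) - φ (x - y)

lemma sdiff2_bound {N : ℕ} {φ : EN N → ℝ} (h1 : ContDiff ℝ (⊤ : ℕ∞) φ)
    (h2 : HasCompactSupport φ) : ∃ M > 0, (∀ x, |φ x| ≤ M) ∧
      ∀ x y, |sdiff2 φ x y| ≤ M * min (‖y‖ ^ 2) 1 := by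
  obtain ⟨M0, hM0⟩ := h1.continuous.bounded_above_of_compact_support h2
  have hd : ContDiff ℝ 1 (fderiv ℝ φ) := h1.fderiv_right (by norm_cast)
  obtain ⟨C, hC⟩ := hd.lipschitzWith_of_hasCompactSupport (h2.fderiv (𝕜 := ℝ)) (by norm_num)
  have hM00 : 0 ≤ M0 := (norm_nonneg _).trans (hM0 0)
  refine ⟨4 * M0 + 2 * C + 1, by positivity, fun x => ?_, fun x y => ?_⟩
  · have := hM0 x
    rw [Real.norm_eq_abs] at this
    have : (0:ℝ) ≤ C := C.2
    linarith
  · have a1 : |sdiff2 φ x y| ≤ 4 * M0 := by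
      have h1 := abs_le.1 (hM0 x); have h2 := abs_le.1 (hM0 (x+y))
      have h3 := abs_le.1 (hM0 (x-y))
      rw [abs_le]; unfold sdiff2
      constructor <;> linarith
    have a2 : |sdiff2 φ x y| ≤ 2 * C * ‖y‖ ^ 2 := by
      have hdiff : Differentiable ℝ φ := h1.differentiable (by simp)
      have hder : ∀ w ∈ closedBall (0:EN N) ‖y‖, HasFDerivWithinAt
          (fun w => φ (x + w) + φ (x - w)) (fderiv ℝ φ (x+w) - fderiv ℝ φ (x-w))
          (closedBall (0:EN N) ‖y‖) w := by
        intro w _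
        have e1 : HasFDerivAt (fun w => φ (x + w)) (fderiv ℝ φ (x+w)) w := by
          have := (hdiff (x+w)).hasFDerivAt.comp w ((hasFDerivAt_id w).const_add x)
          simpa [Function.comp_def] using this
        have e2 : HasFDerivAt (fun w => φ (x - w)) (-fderiv ℝ φ (x-w)) w := by
          have := (hdiff (x-w)).hasFDerivAt.comp w ((hasFDerivAt_id w).const_sub x)
          simpa [Function.comp_def] using this
        rw [sub_eq_add_neg]
        exact (e1.add e2).hasFDerivWithinAt
      have hb : ∀ w ∈ closedBall (0:EN N) ‖y‖, ‖fderiv ℝ φ (x+w) - fderiv ℝ φ (x-w)‖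
          ≤ 2 * C * ‖y‖ := by
        intro w hw
        have := hC.norm_sub_le (x+w) (x-w)
        have hw : ‖w‖ ≤ ‖y‖ := by simpa using hw
        have e : ‖(x + w) - (x - w)‖ ≤ 2 * ‖y‖ := by
          rw [show (x+w) - (x-w) = w + w by abel]
          linarith [norm_add_le w w]
        have hC0 : (0:ℝ) ≤ C := C.2
        nlinarith
      have := (convex_closedBall (0:EN N) ‖y‖).norm_image_sub_le_of_norm_hasFDerivWithin_le
        hder hb (x := 0) (y := y) (by simp) (by simp)
      simp only [add_zero, sub_zero, Real.norm_eq_abs] at this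
      rw [abs_sub_comm] at this
      calc _ = |φ x + φ x - (φ (x + y) + φ (x - y))| := by unfold sdiff2; ring_nf
        _ ≤ _ := this
        _ = _ := by ring
    have hC0 : (0:ℝ) ≤ C := C.2
    rcases min_choice (‖y‖^2) 1 with h | h <;> rw [h]
    · nlinarith [sq_nonneg ‖y‖]
    · linarith

lemma w_int {N : ℕ} (hN : 2 ≤ N) {s : ℝ} (hs0 : 0 < s) (hs1 : s < 1) :
    Integrable (fun y : EN N => min (‖y‖ ^ 2) 1 / ‖y‖ ^ ((N:ℝ) + 2*s)) := by
  refine radial_int hN (fun r => min (r^2) 1 / r ^ ((N:ℝ) + 2*s)) ?_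
  rw [← Ioc_union_Ioi_eq_Ioi zero_le_one]
  refine IntegrableOn.union ?_ ?_
  · have h : IntegrableOn (fun r : ℝ => r ^ (1 - 2*s)) (Ioc 0 1) := by
      rw [← intervalIntegrable_iff_integrableOn_Ioc_of_le zero_le_one]
      exact intervalIntegral.intervalIntegrable_rpow' (by linarith)
    refine h.congr_fun (fun r hr => ?_) measurableSet_Ioc
    simp only
    rw [min_eq_left (by nlinarith [hr.1, hr.2]), div_eq_mul_inv, ← Real.rpow_neg hr.1.le,
      ← Real.rpow_natCast, ← Real.rpow_add hr.1, ← Real.rpow_add hr.1]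
    congr 1; push_cast; ring
  · have h : IntegrableOn (fun r : ℝ => r ^ (-1 - 2*s)) (Ioi 1) :=
      integrableOn_Ioi_rpow_of_lt (by linarith) one_pos
    refine h.congr_fun (fun r hr => ?_) measurableSet_Ioi
    have hr : 1 < r := hr
    have hr0 : 0 < r := by linarith
    simp only
    rw [min_eq_right (by nlinarith), div_eq_mul_inv, ← Real.rpow_neg hr0.le, one_mul,
      ← Real.rpow_add hr0]
    congr 1; ring

/-- the fractional Laplacian through second differences -/
def glap (N : ℕ) (s : ℝ) (φ : EN N → ℝ) (x : EN N) : ℝ :=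
  CNs N s / 2 * ∫ y, sdiff2 φ x y / ‖y‖ ^ ((N:ℝ) + 2*s)

lemma CNs_pos {N : ℕ} (hN : 2 ≤ N) {s : ℝ} (hs0 : 0 < s) (hs1 : s < 1) : 0 < CNs N s := by
  unfold CNs
  have h1 := Real.Gamma_pos_of_pos (show 0 < ((N:ℝ) + 2*s)/2 by positivity)
  have h2 := Real.Gamma_pos_of_pos (show 0 < 1 - s by linarith)
  have := Real.pi_pos
  positivity

lemma sdiff2_meas {N : ℕ} {φ : EN N → ℝ} (h1 : Continuous φ) :
    Continuous (fun p : EN N × EN N => sdiff2 φ p.1 p.2) := by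
  unfold sdiff2; fun_prop

lemma sdiff2_int {N : ℕ} (hN : 2 ≤ N) {s : ℝ} (hs0 : 0 < s) (hs1 : s < 1) {φ : EN N → ℝ}
    (h1 : ContDiff ℝ (⊤ : ℕ∞) φ) (h2 : HasCompactSupport φ) (x : EN N) :
    Integrable (fun y => sdiff2 φ x y / ‖y‖ ^ ((N:ℝ) + 2*s)) := by
  obtain ⟨M, hM, -, hb⟩ := sdiff2_bound h1 h2
  have hc : Continuous (fun y => sdiff2 φ x y) :=
    (sdiff2_meas h1.continuous).comp (by fun_prop : Continuous fun y : EN N => (x, y))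
  refine ((w_int hN hs0 hs1).const_mul M).mono' ?_ (Eventually.of_forall fun y => ?_)
  · have := hc.measurable
    exact Measurable.aestronglyMeasurable (by fun_prop)
  · rw [norm_div, Real.norm_eq_abs, Real.norm_of_nonneg (by positivity), ← mul_div_assoc]
    gcongr
    exact hb x y

lemma glap_bound {N : ℕ} (hN : 2 ≤ N) {s : ℝ} (hs0 : 0 < s) (hs1 : s < 1) {φ : EN N → ℝ}
    (h1 : ContDiff ℝ (⊤ : ℕ∞) φ) (h2 : HasCompactSupport φ) :
    ∃ B > 0, ∀ x, |glap N s φ x| ≤ B := by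
  obtain ⟨M, hM, -, hb⟩ := sdiff2_bound h1 h2
  have hC := CNs_pos hN hs0 hs1
  set W := ∫ y : EN N, M * (min (‖y‖ ^ 2) 1 / ‖y‖ ^ ((N:ℝ) + 2*s))
  have hW : 0 ≤ W := integral_nonneg fun y => by positivity
  refine ⟨CNs N s / 2 * W + 1, by positivity, fun x => ?_⟩
  unfold glap
  rw [abs_mul, abs_of_pos (by positivity : 0 < CNs N s / 2)]
  have : |∫ y, sdiff2 φ x y / ‖y‖ ^ ((N:ℝ) + 2*s)| ≤ W := by
    rw [← Real.norm_eq_abs]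
    refine norm_integral_le_of_norm_le ((w_int hN hs0 hs1).const_mul M)
      (Eventually.of_forall fun y => ?_)
    rw [norm_div, Real.norm_eq_abs, Real.norm_of_nonneg (by positivity), ← mul_div_assoc]
    gcongr
    exact hb x y
  nlinarith

lemma glap_meas {N : ℕ} {s : ℝ} {φ : EN N → ℝ}
    (h1 : ContDiff ℝ (⊤ : ℕ∞) φ) : StronglyMeasurable (glap N s φ) := by
  unfold glap
  refine StronglyMeasurable.const_mul ?_ _
  have := (sdiff2_meas h1.continuous).measurable
  have h : Measurable (fun p : EN N × EN N => sdiff2 φ p.1 p.2 / ‖p.2‖ ^ ((N:ℝ) + 2*s)) := by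
    fun_prop
  exact h.stronglyMeasurable.integral_prod_right

lemma glap_hasFracLap {N : ℕ} (hN : 2 ≤ N) {s : ℝ} (hs0 : 0 < s) (hs1 : s < 1) {φ : EN N → ℝ}
    (h1 : ContDiff ℝ (⊤ : ℕ∞) φ) (h2 : HasCompactSupport φ) (x : EN N) :
    HasFracLap N s φ x (glap N s φ x) := by
  obtain ⟨M, hM, hbM, hb⟩ := sdiff2_bound h1 h2
  set P := (N:ℝ) + 2*s with hP
  have hφm := h1.continuous.measurable
  have hset : ∀ ε : ℝ, MeasurableSet {y : EN N | ε ≤ ‖y‖} := fun ε =>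
    measurableSet_le measurable_const measurable_norm
  have key : ∀ ε > 0, ∫ z in {z : EN N | ε ≤ dist x z}, (φ x - φ z) / dist x z ^ P =
      1/2 * ∫ y, {y : EN N | ε ≤ ‖y‖}.indicator (fun y => sdiff2 φ x y / ‖y‖ ^ P) y := by
    intro ε hε
    have hset2 : MeasurableSet {z : EN N | ε ≤ dist x z} :=
      measurableSet_le measurable_const (by fun_prop)
    rw [← integral_indicator hset2]
    set G : EN N → ℝ := {z : EN N | ε ≤ dist x z}.indicator (fun z => (φ x - φ z) / dist x z ^ P)
      with hG
    have e1 : ∫ y, G (x + y) = ∫ z, G z := integral_add_left_eq_self G x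
    have e2 : ∫ y, G (x - y) = ∫ z, G z := integral_sub_left_eq_self G volume x
    have hi : ∀ ψ : EN N → EN N, Measurable ψ → Integrable (fun y =>
        {y : EN N | ε ≤ ‖y‖}.indicator (fun y => (φ x - φ (ψ y)) / ‖y‖ ^ P) y) := by
      intro ψ hψ
      refine ((w_int hN hs0 hs1).const_mul (2 * M / min (ε^2) 1)).mono' ?_
        (Eventually.of_forall fun y => ?_)
      · refine Measurable.aestronglyMeasurable (Measurable.indicator ?_ (hset ε))
        fun_prop
      · by_cases hy : ε ≤ ‖y‖
        · rw [indicator_of_mem (show y ∈ {y : EN N | ε ≤ ‖y‖} from hy), norm_div,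
            Real.norm_eq_abs, Real.norm_of_nonneg (by positivity), ← mul_div_assoc]
          gcongr
          have hmin : 0 < min (ε^2) 1 := by positivity
          have hle : min (ε^2) 1 ≤ min (‖y‖^2) 1 := by gcongr
          have a1 : |φ x - φ (ψ y)| ≤ 2 * M := by
            have h1 := abs_le.1 (hbM x); have h2 := abs_le.1 (hbM (ψ y))
            rw [abs_le]; constructor <;> linarith
          calc _ ≤ 2 * M := a1
            _ = 2 * M / min (ε^2) 1 * min (ε^2) 1 := by field_simp
            _ ≤ _ := by gcongr
        · rw [indicator_of_notMem (show y ∉ {y : EN N | ε ≤ ‖y‖} from hy), norm_zero]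
          positivity
    have f1 : (fun y => G (x + y)) = fun y =>
        {y : EN N | ε ≤ ‖y‖}.indicator (fun y => (φ x - φ (x + y)) / ‖y‖ ^ P) y := by
      funext y; simp [hG, indicator, dist_eq_norm]
    have f2 : (fun y => G (x - y)) = fun y =>
        {y : EN N | ε ≤ ‖y‖}.indicator (fun y => (φ x - φ (x - y)) / ‖y‖ ^ P) y := by
      funext y; simp [hG, indicator, dist_eq_norm]
    have e3 : ∫ y, {y : EN N | ε ≤ ‖y‖}.indicator (fun y => sdiff2 φ x y / ‖y‖ ^ P) y =
        (∫ y, G (x + y)) + ∫ y, G (x - y) := by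
      rw [f1, f2, ← integral_add (hi _ (by fun_prop)) (hi _ (by fun_prop))]
      refine integral_congr_ae (Eventually.of_forall fun y => ?_)
      by_cases hy : ε ≤ ‖y‖
      · simp only [indicator, mem_ofPred_eq, hy, if_true, sdiff2]; ring
      · simp [indicator, hy]
    rw [e3, e1, e2]; ring
  have hlim : Tendsto (fun ε : ℝ => ∫ y, {y : EN N | ε ≤ ‖y‖}.indicator
      (fun y => sdiff2 φ x y / ‖y‖ ^ P) y) (𝓝[>] 0) (𝓝 (∫ y, sdiff2 φ x y / ‖y‖ ^ P)) := by
    have hI := sdiff2_int hN hs0 hs1 h1 h2 x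
    refine tendsto_integral_filter_of_dominated_convergence _
      (Eventually.of_forall fun ε => hI.aestronglyMeasurable.indicator (hset ε))
      (Eventually.of_forall fun ε => Eventually.of_forall fun y => norm_indicator_le_norm_self _ _)
      hI.norm ?_
    filter_upwards [ae_ne hN 0] with y hy
    refine tendsto_const_nhds.congr' ?_
    have : Iio ‖y‖ ∈ 𝓝[>] (0:ℝ) := mem_nhdsWithin_of_mem_nhds (Iio_mem_nhds (norm_pos_iff.2 hy))
    filter_upwards [this] with ε hε
    rw [indicator_of_mem]
    exact (show ε < ‖y‖ from hε).le
  unfold HasFracLap glap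
  have := (hlim.const_mul (1/2)).const_mul (CNs N s)
  rw [show CNs N s / 2 * ∫ y, sdiff2 φ x y / ‖y‖ ^ P =
    CNs N s * (1/2 * ∫ y, sdiff2 φ x y / ‖y‖ ^ P) by ring]
  refine this.congr' ?_
  filter_upwards [self_mem_nhdsWithin] with ε hε
  rw [key ε hε]

lemma glap_rep {N : ℕ} (hN : 2 ≤ N) {s : ℝ} (hs0 : 0 < s) (hs1 : s < 1) {φ : EN N → ℝ}
    (h1 : ContDiff ℝ (⊤ : ℕ∞) φ) (h2 : HasCompactSupport φ) (x : EN N) :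
    IntegrableOn (fun l : ℝ => l ^ ((N:ℝ)/2 + s - 1) * Dh N φ x l) (Ioi 0) ∧
    kap N s * ∫ l in Ioi (0:ℝ), l ^ ((N:ℝ)/2 + s - 1) * Dh N φ x l = glap N s φ x := by
  have hI := sdiff2_int hN hs0 hs1 h1 h2 x
  have hc : Continuous (fun y => sdiff2 φ x y) :=
    (sdiff2_meas h1.continuous).comp (by fun_prop : Continuous fun y : EN N => (x, y))
  obtain ⟨M, hM, hbM, hb⟩ := sdiff2_bound h1 h2
  obtain ⟨k1, k2⟩ := lk hN hs0 (fun y => sdiff2 φ x y) 0 hc.aestronglyMeasurable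
    (by simpa using hI)
  simp only [zero_sub, norm_neg] at k1 k2
  have hD : ∀ l ∈ Ioi (0:ℝ), l ^ ((N:ℝ)/2 + s - 1) * Dh N φ x l =
      1/2 * (l ^ ((N:ℝ)/2 + s - 1) * ∫ y, sdiff2 φ x y * Real.exp (-(l * ‖y‖ ^ 2))) := by
    intro l hl
    have hφm := h1.continuous
    set G : EN N → ℝ := fun z => (φ x - φ z) * Real.exp (-(l * ‖x - z‖ ^ 2)) with hG
    have e1 : ∫ y, G (x + y) = ∫ z, G z := integral_add_left_eq_self G x
    have e2 : ∫ y, G (x - y) = ∫ z, G z := integral_sub_left_eq_self G volume x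
    have hGi : Integrable G := by
      refine ((gauss_int hN hl x).const_mul (2*M)).mono' 
        (Continuous.aestronglyMeasurable (by fun_prop)) (Eventually.of_forall fun y => ?_)
      rw [norm_mul, Real.norm_of_nonneg (Real.exp_pos _).le, Real.norm_eq_abs]
      gcongr
      have h1 := abs_le.1 (hbM x); have h2 := abs_le.1 (hbM y)
      rw [abs_le]; constructor <;> linarith
    have e3 : ∫ y, sdiff2 φ x y * Real.exp (-(l * ‖y‖ ^ 2)) =
        (∫ y, G (x + y)) + ∫ y, G (x - y) := by
      rw [← integral_add (hGi.comp_add_left x) (hGi.comp_sub_left x)]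
      refine integral_congr_ae (Eventually.of_forall fun y => ?_)
      simp only [hG, sdiff2, sub_add_cancel_left, norm_neg, sub_sub_cancel]
      ring
    rw [e3, e1, e2]
    unfold Dh
    ring
  constructor
  · refine IntegrableOn.congr_fun (k1.const_mul (1/2)) (fun l hl => (hD l hl).symm)
      measurableSet_Ioi
  · rw [setIntegral_congr_fun measurableSet_Ioi hD, integral_const_mul, k2]
    unfold kap glap
    have hG2 : Real.Gamma ((N:ℝ)/2 + s) ≠ 0 := (Real.Gamma_pos_of_pos (by positivity)).ne'
    field_simp

lemma glap_decay {N : ℕ} (hN : 2 ≤ N) {s : ℝ} (hs0 : 0 < s) (hs1 : s < 1) {φ : EN N → ℝ}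
    (h1 : ContDiff ℝ (⊤ : ℕ∞) φ) (h2 : HasCompactSupport φ) :
    ∃ C > 0, ∀ x, |glap N s φ x| ≤ C / (1 + ‖x‖ ^ ((N:ℝ) + 2*s)) := by
  obtain ⟨B, hB, hgB⟩ := glap_bound hN hs0 hs1 h1 h2
  have hC := CNs_pos hN hs0 hs1
  set P := (N:ℝ) + 2*s with hP
  have hPpos : 0 < P := by positivity
  obtain ⟨R0, hR0⟩ := h2.isBounded.subset_closedBall (0:EN N)
  set R := max R0 1 with hR
  have hR1 : 1 ≤ R := le_max_right _ _
  have hsup : ∀ z : EN N, R < ‖z‖ → φ z = 0 := by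
    intro z hz
    by_contra h
    have := hR0 (subset_tsupport φ h)
    rw [mem_closedBall_zero_iff] at this
    linarith [le_max_left R0 1]
  have hφi : Integrable φ := h1.continuous.integrable_of_hasCompactSupport h2
  set I := ∫ z, |φ z| with hI
  have hI0 : 0 ≤ I := integral_nonneg fun z => abs_nonneg _
  refine ⟨B * (1 + (2*R)^P) + CNs N s * I * 2 ^ P * 2, by positivity, fun x => ?_⟩
  by_cases hx : ‖x‖ ≤ 2 * R
  · refine (hgB x).trans ?_
    rw [le_div_iff₀ (by positivity)]
    have : B * (1 + ‖x‖^P) ≤ B * (1 + (2*R)^P) := by gcongr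
    have : 0 ≤ CNs N s * I * 2 ^ P * 2 := by positivity
    linarith
  · push Not at hx
    have hx0 : 0 < ‖x‖ := by linarith
    have hφx : φ x = 0 := hsup x (by linarith)
    have hbd : |glap N s φ x| ≤ CNs N s * (I / (‖x‖/2)^P) := by
      have ht := (glap_hasFracLap hN hs0 hs1 h1 h2 x).abs
      refine le_of_tendsto ht (Eventually.of_forall fun ε => ?_)
      rw [abs_mul, abs_of_pos hC]
      gcongr
      rw [← Real.norm_eq_abs, hI, ← integral_div]
      have hm : Integrable (fun z => |φ z| / (‖x‖/2)^P) := hφi.abs.div_const _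
      refine (norm_integral_le_of_norm_le hm.integrableOn 
        (Eventually.of_forall fun z => ?_)).trans
        (setIntegral_le_integral hm (Eventually.of_forall fun z => ?_))
      · by_cases hz : R < ‖z‖
        · simp [hφx, hsup z hz]
        · push Not at hz
          rw [norm_div, hφx, zero_sub, norm_neg, Real.norm_eq_abs,
            Real.norm_of_nonneg (by positivity)]
          gcongr
          rw [dist_eq_norm]
          linarith [norm_sub_norm_le x z]
      · simp only [Pi.zero_apply]; positivity
    refine hbd.trans ?_
    rw [Real.div_rpow hx0.le (by norm_num)]
    have h1 : 1 ≤ ‖x‖^P := Real.one_le_rpow (by linarith) hPpos.le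
    have e : CNs N s * (I / (‖x‖^P / 2^P)) = CNs N s * I * 2^P * (1/ ‖x‖^P) := by
      field_simp
    have e2 : 1 / ‖x‖^P ≤ 2 / (1 + ‖x‖^P) := by
      rw [div_le_div_iff₀ (by positivity) (by positivity)]; linarith
    rw [e]
    calc _ ≤ CNs N s * I * 2^P * (2 / (1 + ‖x‖^P)) := by gcongr
      _ = CNs N s * I * 2 ^ P * 2 / (1 + ‖x‖^P) := by ring
      _ ≤ _ := by
        gcongr
        have : 0 ≤ B * (1 + (2*R)^P) := by positivity
        linarith

lemma glap_int {N : ℕ} (hN : 2 ≤ N) {s : ℝ} (hs0 : 0 < s) (hs1 : s < 1) {φ : EN N → ℝ}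
    (h1 : ContDiff ℝ (⊤ : ℕ∞) φ) (h2 : HasCompactSupport φ) {u : EN N → ℝ} (hu : MemL1w N s u) :
    AEStronglyMeasurable u ∧ Integrable (fun x => u x * glap N s φ x) := by
  have hum : AEStronglyMeasurable u := by
    have := hu.aestronglyMeasurable.mul
      (Measurable.aestronglyMeasurable (by fun_prop :
        Measurable fun x : EN N => (1 + ‖x‖ ^ ((N:ℝ) + 2*s))))
    refine this.congr (Eventually.of_forall fun x => ?_)
    have : (0:ℝ) < 1 + ‖x‖ ^ ((N:ℝ) + 2*s) := by positivity
    simp only [Pi.mul_apply]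
    field_simp
  refine ⟨hum, ?_⟩
  obtain ⟨C, hC, hb⟩ := glap_decay hN hs0 hs1 h1 h2
  refine (hu.norm.const_mul C).mono' (hum.mul (glap_meas h1).aestronglyMeasurable)
    (Eventually.of_forall fun x => ?_)
  have : (0:ℝ) < 1 + ‖x‖ ^ ((N:ℝ) + 2*s) := by positivity
  rw [norm_mul, norm_div, Real.norm_of_nonneg this.le, Real.norm_eq_abs (glap N s φ x)]
  calc _ ≤ ‖u x‖ * (C / (1 + ‖x‖ ^ ((N:ℝ) + 2*s))) := by gcongr; exact hb x
    _ = _ := by ring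

/-- smooth convex approximation of the positive part -/
def hfun (η t : ℝ) : ℝ := t * expNegInvGlue (t / η)

lemma hfun_contDiff (η : ℝ) : ContDiff ℝ (⊤ : ℕ∞) (hfun η) := by
  unfold hfun
  exact contDiff_id.mul (expNegInvGlue.contDiff.comp (contDiff_id.div_const η))

lemma hfun_nonpos {η t : ℝ} (hη : 0 < η) (ht : t ≤ 0) : hfun η t = 0 := by
  unfold hfun
  rw [expNegInvGlue.zero_of_nonpos (div_nonpos_of_nonpos_of_nonneg ht hη.le), mul_zero]

lemma hfun_pos {η t : ℝ} (hη : 0 < η) (ht : 0 < t) : hfun η t = t * Real.exp (-(η / t)) := by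
  unfold hfun expNegInvGlue
  rw [if_neg (not_le.2 (by positivity)), inv_div]

lemma hfun_nonneg {η t : ℝ} (hη : 0 < η) : 0 ≤ hfun η t := by
  rcases le_or_gt t 0 with h | h
  · rw [hfun_nonpos hη h]
  · rw [hfun_pos hη h]; positivity

lemma hfun_tangent {η t : ℝ} (hη : 0 < η) (ht : 0 < t) :
    ∃ p e : ℝ, 0 ≤ p ∧ p ≤ 1 ∧ 0 ≤ e ∧ e ≤ 1 ∧ hfun η t = p * t - η * e ∧
      ∀ y, hfun η t + p * (y - t) ≤ hfun η y := by
  set e := Real.exp (-(η / t)) with he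
  have he0 : 0 < e := Real.exp_pos _
  have hw : 0 < η / t := by positivity
  refine ⟨e * (1 + η / t), e, by positivity, ?_, he0.le, ?_, ?_, ?_⟩
  · have h1 : 1 + η / t ≤ Real.exp (η / t) := by linarith [Real.add_one_le_exp (η / t)]
    calc e * (1 + η/t) ≤ e * Real.exp (η / t) := by gcongr
      _ = 1 := by rw [he, ← Real.exp_add]; simp
  · rw [he]; exact Real.exp_le_one_iff.2 (by linarith)
  · rw [hfun_pos hη ht, ← he]; field_simp; ring
  · intro y
    rw [hfun_pos hη ht, ← he]
    have e1 : t * e + e * (1 + η / t) * (y - t) = e * (y * (1 + η / t) - η) := by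
      field_simp; ring
    rw [e1]
    rcases le_or_gt y 0 with h | h
    · rw [hfun_nonpos hη h]
      refine mul_nonpos_of_nonneg_of_nonpos he0.le ?_
      nlinarith
    · rw [hfun_pos hη h]
      have h1 : 1 + (η / t - η / y) ≤ Real.exp (η / t - η / y) := by
        linarith [Real.add_one_le_exp (η / t - η / y)]
      have h2 : Real.exp (-(η / y)) = e * Real.exp (η / t - η / y) := by
        rw [he, ← Real.exp_add]; ring_nf
      rw [h2]
      calc e * (y * (1 + η / t) - η) = y * (e * (1 + (η/t - η/y))) := by field_simp; ring
        _ ≤ _ := by gcongr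

/-- test function -/
def tfun (N : ℕ) (ρ r0 η : ℝ) (v : EN N → ℝ) (x : EN N) : ℝ :=
  open Classical in if ρ/2 < ‖x‖ ∧ ‖x‖ < 2*r0 then hfun η (v x) else 0

section
variable {N : ℕ} {ρ r0 η : ℝ} {v : EN N → ℝ}

lemma tfun_nonneg (hη : 0 < η) (x : EN N) : 0 ≤ tfun N ρ r0 η v x := by
  unfold tfun; split_ifs
  · exact hfun_nonneg hη
  · exact le_rfl

lemma tfun_eq (hη : 0 < η) (hv1 : ∀ x, 0 < ‖x‖ → ‖x‖ ≤ ρ → v x ≤ 0) (x : EN N) (hx : 0 < ‖x‖)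
    (hx2 : ‖x‖ < 2*r0) : tfun N ρ r0 η v x = hfun η (v x) := by
  unfold tfun
  split_ifs with h
  · rfl
  · have : ‖x‖ ≤ ρ/2 := by
      by_contra hc; exact h ⟨by linarith, hx2⟩
    rw [hfun_nonpos hη (hv1 x hx (by linarith))]

lemma tfun_zero (hη : 0 < η) (hρ : 0 < ρ) (hv1 : ∀ x, 0 < ‖x‖ → ‖x‖ ≤ ρ → v x ≤ 0)
    (hv2 : ∀ x, r0 ≤ ‖x‖ → ‖x‖ ≤ 2*r0 → v x ≤ 0) (x : EN N)
    (hx : ‖x‖ ≤ ρ ∨ r0 ≤ ‖x‖) : tfun N ρ r0 η v x = 0 := by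
  unfold tfun
  split_ifs with h
  · refine hfun_nonpos hη ?_
    rcases hx with hx | hx
    · exact hv1 x (by linarith [h.1]) hx
    · exact hv2 x hx h.2.le
  · rfl

lemma tfun_tsupport (hη : 0 < η) (hρ : 0 < ρ) (hv1 : ∀ x, 0 < ‖x‖ → ‖x‖ ≤ ρ → v x ≤ 0)
    (hv2 : ∀ x, r0 ≤ ‖x‖ → ‖x‖ ≤ 2*r0 → v x ≤ 0) :
    tsupport (tfun N ρ r0 η v) ⊆ {x | ρ ≤ ‖x‖ ∧ ‖x‖ ≤ r0} := by
  refine closure_minimal (fun x hx => ?_) ?_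
  · by_contra h
    apply hx
    refine tfun_zero hη hρ hv1 hv2 x ?_
    by_contra hc
    push Not at hc
    exact h ⟨hc.1.le, hc.2.le⟩
  · exact (isClosed_le continuous_const continuous_norm).inter
      (isClosed_le continuous_norm continuous_const)

lemma tfun_compact (hη : 0 < η) (hρ : 0 < ρ) (hv1 : ∀ x, 0 < ‖x‖ → ‖x‖ ≤ ρ → v x ≤ 0)
    (hv2 : ∀ x, r0 ≤ ‖x‖ → ‖x‖ ≤ 2*r0 → v x ≤ 0) :
    HasCompactSupport (tfun N ρ r0 η v) := by
  refine HasCompactSupport.of_support_subset_isCompact (isCompact_closedBall (0:EN N) r0) ?_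
  intro x hx
  have := tfun_tsupport hη hρ hv1 hv2 (subset_tsupport _ hx)
  simpa using this.2

lemma tfun_contDiff (hη : 0 < η) (hρ : 0 < ρ) (hr : ρ < r0)
    (hv1 : ∀ x, 0 < ‖x‖ → ‖x‖ ≤ ρ → v x ≤ 0)
    (hv2 : ∀ x, r0 ≤ ‖x‖ → ‖x‖ ≤ 2*r0 → v x ≤ 0)
    (hvs : ∀ x, x ≠ 0 → ContDiffAt ℝ (⊤ : ℕ∞) v x) :
    ContDiff ℝ (⊤ : ℕ∞) (tfun N ρ r0 η v) := by
  rw [contDiff_iff_contDiffAt]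
  intro x
  by_cases h1 : ‖x‖ < ρ
  · have : tfun N ρ r0 η v =ᶠ[𝓝 x] fun _ => 0 := by
      filter_upwards [(isOpen_lt continuous_norm continuous_const).mem_nhds h1] with z hz
      exact tfun_zero hη hρ hv1 hv2 z (Or.inl (le_of_lt hz))
    exact contDiffAt_const.congr_of_eventuallyEq this
  by_cases h2 : r0 < ‖x‖
  · have : tfun N ρ r0 η v =ᶠ[𝓝 x] fun _ => 0 := by
      filter_upwards [(isOpen_lt continuous_const continuous_norm).mem_nhds h2] with z hz
      exact tfun_zero hη hρ hv1 hv2 z (Or.inr (le_of_lt hz))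
    exact contDiffAt_const.congr_of_eventuallyEq this
  push Not at h1 h2
  have hx0 : x ≠ 0 := by rw [← norm_pos_iff]; linarith
  have : tfun N ρ r0 η v =ᶠ[𝓝 x] fun z => hfun η (v z) := by
    filter_upwards [(isOpen_lt continuous_const continuous_norm).mem_nhds
        (show ρ/2 < ‖x‖ by linarith),
      (isOpen_lt continuous_norm continuous_const).mem_nhds (show ‖x‖ < 2*r0 by linarith)]
      with z hz1 hz2
    unfold tfun
    rw [if_pos ⟨hz1, hz2⟩]
  exact ((hfun_contDiff η).contDiffAt.comp x (hvs x hx0)).congr_of_eventuallyEq this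
end

lemma kap_pos {N : ℕ} (hN : 2 ≤ N) {s : ℝ} (hs0 : 0 < s) (hs1 : s < 1) : 0 < kap N s :=
  div_pos (CNs_pos hN hs0 hs1) (Real.Gamma_pos_of_pos (by positivity))

lemma int_comb {α : Type*} [MeasurableSpace α] {m : Measure α} {a b c d : α → ℝ}
    (ia : Integrable a m) (ib : Integrable b m) (ic : Integrable c m) (id : Integrable d m)
    (p δ A : ℝ) :
    Integrable (fun x => p * (a x - δ * b x + A * c x) + d x) m ∧
    ∫ x, (p * (a x - δ * b x + A * c x) + d x) ∂m =
      p * ((∫ x, a x ∂m) - δ * (∫ x, b x ∂m) + A * ∫ x, c x ∂m) + ∫ x, d x ∂m := by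
  have i1 : Integrable (fun x => δ * b x) m := ib.const_mul δ
  have i2 : Integrable (fun x => a x - δ * b x) m := ia.sub i1
  have i3 : Integrable (fun x => A * c x) m := ic.const_mul A
  have i4 : Integrable (fun x => a x - δ * b x + A * c x) m := i2.add i3
  have i5 : Integrable (fun x => p * (a x - δ * b x + A * c x)) m := i4.const_mul p
  refine ⟨i5.add id, ?_⟩
  rw [integral_add i5 id, integral_const_mul, integral_add i2 i3, integral_sub ia i1,
    integral_const_mul, integral_const_mul]

lemma glap_compare {N : ℕ} (hN : 2 ≤ N) {s : ℝ} (hs0 : 0 < s) (hs1 : s < 1) {φ χ : EN N → ℝ}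
    (h1 : ContDiff ℝ (⊤ : ℕ∞) φ) (h2 : HasCompactSupport φ)
    (h1' : ContDiff ℝ (⊤ : ℕ∞) χ) (h2' : HasCompactSupport χ) (x : EN N) (hx : x ≠ 0)
    {σ σ' : ℝ} (hσ : -(N:ℝ) < σ) (hσ2 : σ < 2*s) (hσ' : -(N:ℝ) < σ') (hσ2' : σ' < 2*s)
    {p δ A : ℝ} {T : EN N → ℝ} (hTm : AEStronglyMeasurable T)
    (hTg : ∀ l : ℝ, 0 < l → Integrable (fun z => T z * Real.exp (-(l * ‖x - z‖ ^ 2))))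
    (hTi : Integrable (fun z => T z / ‖x - z‖ ^ ((N:ℝ) + 2*s)))
    (hle : ∀ z, z ≠ 0 → φ x - φ z ≤ p * ((‖x‖^σ - ‖z‖^σ) - δ * (‖x‖^σ' - ‖z‖^σ')
      + A * (χ x - χ z)) + T z) :
    glap N s φ x ≤ p * (csFun N s σ * (‖x‖ ^ σ * ‖x‖ ^ (-(2*s)))
      - δ * (csFun N s σ' * (‖x‖ ^ σ' * ‖x‖ ^ (-(2*s)))) + A * glap N s χ x)
      + CNs N s * ∫ z, T z / ‖x - z‖ ^ ((N:ℝ) + 2*s) := by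
  obtain ⟨i1, v1⟩ := glap_rep hN hs0 hs1 h1 h2 x
  obtain ⟨i2, v2⟩ := glap_rep hN hs0 hs1 h1' h2' x
  obtain ⟨i3, v3⟩ := pow_lap hN hs0 hs1 hσ hσ2 x hx
  obtain ⟨i4, v4⟩ := pow_lap hN hs0 hs1 hσ' hσ2' x hx
  obtain ⟨i5, v5⟩ := lk hN hs0 T x hTm hTi
  have hk := kap_pos hN hs0 hs1
  have hG2 : Real.Gamma ((N:ℝ)/2 + s) ≠ 0 := (Real.Gamma_pos_of_pos (by positivity)).ne'
  have v5' : CNs N s * ∫ z, T z / ‖x - z‖ ^ ((N:ℝ) + 2*s) = kap N s *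
    ∫ l in Ioi (0:ℝ), l ^ ((N:ℝ)/2 + s - 1) * ∫ z, T z * Real.exp (-(l * ‖x - z‖ ^ 2)) := by
    rw [v5]; unfold kap; field_simp
  have hDi : ∀ ψ : EN N → ℝ, ContDiff ℝ (⊤ : ℕ∞) ψ → HasCompactSupport ψ → ∀ l : ℝ, 0 < l →
      Integrable (fun z => (ψ x - ψ z) * Real.exp (-(l * ‖x - z‖ ^ 2))) := by
    intro ψ g1 g2 l hl
    obtain ⟨M, hM, hbM, -⟩ := sdiff2_bound g1 g2
    have := g1.continuous
    refine ((gauss_int hN hl x).const_mul (2*M)).mono'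
        (Continuous.aestronglyMeasurable (by fun_prop)) (Eventually.of_forall fun y => ?_)
    rw [norm_mul, Real.norm_of_nonneg (Real.exp_pos _).le, Real.norm_eq_abs]
    gcongr
    have h1 := abs_le.1 (hbM x); have h2 := abs_le.1 (hbM y)
    rw [abs_le]; constructor <;> linarith
  have hPi : ∀ σ : ℝ, -(N:ℝ) < σ → ∀ l : ℝ, 0 < l →
      Integrable (fun z => (‖x‖^σ - ‖z‖^σ) * Real.exp (-(l * ‖x - z‖ ^ 2))) := by
    intro σ hσ l hl
    refine (((gauss_int hN hl x).const_mul (‖x‖^σ)).sub (pow_gauss_int hN hσ hl x)).congr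
      (Eventually.of_forall fun z => ?_)
    simp only [Pi.sub_apply]; ring
  have hD : ∀ l ∈ Ioi (0:ℝ), l ^ ((N:ℝ)/2 + s - 1) * Dh N φ x l ≤
      p * (l ^ ((N:ℝ)/2 + s - 1) * Dh N (fun z => ‖z‖ ^ σ) x l
        - δ * (l ^ ((N:ℝ)/2 + s - 1) * Dh N (fun z => ‖z‖ ^ σ') x l)
        + A * (l ^ ((N:ℝ)/2 + s - 1) * Dh N χ x l))
      + l ^ ((N:ℝ)/2 + s - 1) * ∫ z, T z * Real.exp (-(l * ‖x - z‖ ^ 2)) := by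
    intro l hl
    have hl : 0 < l := hl
    have j2 := hDi χ h1' h2' l hl
    have j3 := hPi σ hσ l hl
    have j4 := hPi σ' hσ' l hl
    have j5 := hTg l hl
    have main : Dh N φ x l ≤ p * (Dh N (fun z => ‖z‖ ^ σ) x l - δ * Dh N (fun z => ‖z‖ ^ σ') x l
        + A * Dh N χ x l) + ∫ z, T z * Real.exp (-(l * ‖x - z‖ ^ 2)) := by
      unfold Dh
      obtain ⟨k1, k2⟩ := int_comb j3 j4 j2 j5 p δ A
      rw [← k2]
      refine integral_mono_ae (hDi φ h1 h2 l hl) k1 ?_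
      filter_upwards [ae_ne hN 0] with z hz
      have := mul_le_mul_of_nonneg_right (hle z hz) (Real.exp_pos (-(l * ‖x - z‖ ^ 2))).le
      refine this.trans (le_of_eq ?_)
      ring
    have hp : 0 ≤ l ^ ((N:ℝ)/2 + s - 1) := by positivity
    refine (mul_le_mul_of_nonneg_left main hp).trans (le_of_eq ?_)
    ring
  obtain ⟨j, e⟩ := int_comb i3 i4 i2 i5 p δ A
  have hfin := setIntegral_mono_on i1 j measurableSet_Ioi hD
  have hfin2 := mul_le_mul_of_nonneg_left (hfin.trans (le_of_eq e)) hk.le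
  rw [v1] at hfin2
  rw [← v2, ← v3, ← v4, v5']
  refine hfin2.trans (le_of_eq ?_)
  ring

lemma glap_nonpos {N : ℕ} (hN : 2 ≤ N) {s : ℝ} (hs0 : 0 < s) (hs1 : s < 1) {φ : EN N → ℝ}
    (hφ : ∀ x, 0 ≤ φ x) (x : EN N) (hx : φ x = 0) : glap N s φ x ≤ 0 := by
  unfold glap
  have hC := CNs_pos hN hs0 hs1
  refine mul_nonpos_of_nonneg_of_nonpos (by positivity) (integral_nonpos fun y => ?_)
  refine div_nonpos_of_nonpos_of_nonneg ?_ (by positivity)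
  unfold sdiff2
  linarith [hφ (x+y), hφ (x-y)]

lemma csFun_symm (N : ℕ) (s σ : ℝ) : csFun N s (2*s - N - σ) = csFun N s σ := by
  unfold csFun
  rw [show ((N:ℝ) + (2*s - N - σ))/2 = (2*s-σ)/2 by ring,
    show (2*s - (2*s - N - σ))/2 = (N + σ)/2 by ring,
    show -(2*s - N - σ)/2 = (N - 2*s + σ)/2 by ring,
    show ((N:ℝ) - 2*s + (2*s - N - σ))/2 = -σ/2 by ring]
  ring

lemma rpow_le_sum {r τ σ σb : ℝ} (hr : 0 < r) (h1 : τ ≤ σ) (h2 : σ ≤ σb) :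
    r ^ σ ≤ r ^ τ + r ^ σb := by
  have a := Real.rpow_pos_of_pos hr τ
  have b := Real.rpow_pos_of_pos hr σb
  rcases le_or_gt 1 r with h | h
  · have := Real.rpow_le_rpow_of_exponent_le h h2; linarith
  · have := Real.rpow_le_rpow_of_exponent_ge hr h.le h1; linarith

lemma rpow_le_ends {r a b τ : ℝ} (ha : 0 < a) (h1 : a ≤ r) (h2 : r ≤ b) :
    r ^ τ ≤ a ^ τ + b ^ τ := by
  have hr : 0 < r := by linarith
  have hb : 0 < b := by linarith
  have a' := Real.rpow_pos_of_pos ha τ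
  have b' := Real.rpow_pos_of_pos hb τ
  rcases le_or_gt 0 τ with h | h
  · have := Real.rpow_le_rpow hr.le h2 h; linarith
  · have := Real.rpow_le_rpow_of_nonpos ha h1 h.le; linarith

/-- tail function -/
def tailT (N : ℕ) (r0 τ σb : ℝ) (z : EN N) : ℝ :=
  {z : EN N | 2*r0 ≤ ‖z‖}.indicator (fun z => ‖z‖^τ + ‖z‖^σb) z

lemma tailT_nonneg {N : ℕ} {r0 τ σb : ℝ} (z : EN N) : 0 ≤ tailT N r0 τ σb z :=
  indicator_nonneg (fun z _ => by positivity) z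

lemma tailT_meas {N : ℕ} {r0 τ σb : ℝ} : Measurable (tailT N r0 τ σb) := by
  unfold tailT
  exact Measurable.indicator (by fun_prop) (measurableSet_le measurable_const measurable_norm)

lemma tailT_int0 {N : ℕ} (hN : 2 ≤ N) {s r0 τ σb : ℝ} (hr0 : 0 < r0)
    (hτ : τ < 2*s) (hσb : σb < 2*s) :
    Integrable (fun z => tailT N r0 τ σb z / ‖z‖ ^ ((N:ℝ) + 2*s)) := by
  have := radial_int hN (fun r => (Ici (2*r0)).indicator (fun r => r^τ + r^σb) r / r ^ ((N:ℝ) + 2*s)) ?_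
  · refine this.congr (Eventually.of_forall fun z => ?_)
    simp [tailT, indicator]
  · have h1 : ∀ t : ℝ, t < 2*s → IntegrableOn (fun r : ℝ => r ^ (t - 1 - 2*s)) (Ioi r0) :=
      fun t ht => integrableOn_Ioi_rpow_of_lt (by linarith) hr0
    have h2 : IntegrableOn (fun r : ℝ => r ^ (τ - 1 - 2*s) + r ^ (σb - 1 - 2*s)) (Ioi r0) :=
      (h1 τ hτ).add (h1 σb hσb)
    have h3 : Integrable ((Ici (2*r0)).indicator
        (fun r : ℝ => r ^ (τ - 1 - 2*s) + r ^ (σb - 1 - 2*s))) := by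
      rw [integrable_indicator_iff measurableSet_Ici]
      exact h2.mono_set (fun r hr => by
        have hr : 2*r0 ≤ r := hr
        show r0 < r
        linarith)
    refine (h3.integrableOn).congr_fun (fun r hr => ?_) measurableSet_Ioi
    have hr : 0 < r := hr
    simp only [indicator]
    split_ifs with h
    · rw [div_eq_mul_inv, ← Real.rpow_neg hr.le, add_mul, mul_add, ← Real.rpow_add hr,
        ← Real.rpow_add hr, ← Real.rpow_add hr, ← Real.rpow_add hr]
      congr 2 <;> ring
    · simp

lemma tailT_int {N : ℕ} (hN : 2 ≤ N) {s r0 τ σb : ℝ} (hs0 : 0 < s) (hr0 : 0 < r0)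
    (hτ : τ < 2*s) (hσb : σb < 2*s) (x : EN N) (hx : ‖x‖ < r0) :
    Integrable (fun z => tailT N r0 τ σb z / ‖x - z‖ ^ ((N:ℝ) + 2*s)) ∧
    ∫ z, tailT N r0 τ σb z / ‖x - z‖ ^ ((N:ℝ) + 2*s) ≤
      2 ^ ((N:ℝ) + 2*s) * ∫ z, tailT N r0 τ σb z / ‖z‖ ^ ((N:ℝ) + 2*s) := by
  have hb : ∀ z : EN N, tailT N r0 τ σb z / ‖x - z‖ ^ ((N:ℝ) + 2*s) ≤
      2 ^ ((N:ℝ) + 2*s) * (tailT N r0 τ σb z / ‖z‖ ^ ((N:ℝ) + 2*s)) := by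
    intro z
    by_cases hz : 2 * r0 ≤ ‖z‖
    · have hz0 : 0 < ‖z‖ := by linarith
      have h1 : ‖z‖ / 2 ≤ ‖x - z‖ := by
        have := norm_sub_norm_le z x
        rw [norm_sub_rev] at this
        linarith
      calc _ ≤ tailT N r0 τ σb z / (‖z‖/2) ^ ((N:ℝ) + 2*s) := by
            gcongr
            exact tailT_nonneg z
        _ = _ := by
            rw [Real.div_rpow hz0.le (by norm_num)]
            field_simp
    · have : tailT N r0 τ σb z = 0 := by simp [tailT, indicator, hz]
      simp [this]
  have h0 := (tailT_int0 hN hr0 hτ hσb).const_mul (2 ^ ((N:ℝ) + 2*s))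
  have hI : Integrable (fun z => tailT N r0 τ σb z / ‖x - z‖ ^ ((N:ℝ) + 2*s)) := by
    refine h0.mono' ?_ (Eventually.of_forall fun z => ?_)
    · have := tailT_meas (N := N) (r0 := r0) (τ := τ) (σb := σb)
      exact Measurable.aestronglyMeasurable (by fun_prop)
    · rw [Real.norm_of_nonneg (div_nonneg (tailT_nonneg z) (by positivity))]
      exact hb z
  refine ⟨hI, ?_⟩
  rw [← integral_const_mul]
  exact integral_mono hI h0 hb

lemma tailT_gauss {N : ℕ} (hN : 2 ≤ N) {r0 τ σb : ℝ}
    (hτ : -(N:ℝ) < τ) (hσb : -(N:ℝ) < σb) (x : EN N) {l : ℝ} (hl : 0 < l) :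
    Integrable (fun z => tailT N r0 τ σb z * Real.exp (-(l * ‖x - z‖ ^ 2))) := by
  have := tailT_meas (N := N) (r0 := r0) (τ := τ) (σb := σb)
  refine ((pow_gauss_int hN hτ hl x).add (pow_gauss_int hN hσb hl x)).mono'
    (Measurable.aestronglyMeasurable (by fun_prop)) (Eventually.of_forall fun z => ?_)
  rw [Real.norm_of_nonneg (mul_nonneg (tailT_nonneg z) (Real.exp_pos _).le)]
  simp only [Pi.add_apply]
  rw [← add_mul]
  gcongr
  exact indicator_le_self' (fun z _ => by positivity) z

set_option maxHeartbeats 2000000 in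
lemma test_fn {N : ℕ} (hN : 2 ≤ N) {s μ τp σb r0 : ℝ} (hs0 : 0 < s) (hs1 : s < 1)
    (hτ1 : (2*s - N)/2 ≤ τp) (hσb : σb < 2*s) (hr0 : 0 < r0) :
    ∃ K : ℝ, 0 ≤ K ∧ ∀ σ ρ : ℝ, τp ≤ σ → σ ≤ σb → (2*s - N)/2 < σ → csFun N s σ ≤ -μ →
      0 < ρ → ρ < r0 → ∃ φ : EN N → ℝ, ContDiff ℝ (⊤ : ℕ∞) φ ∧ HasCompactSupport φ ∧
        tsupport φ ⊆ {x | ρ ≤ ‖x‖ ∧ ‖x‖ ≤ r0} ∧ (∀ x, 0 ≤ φ x) ∧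
        (∀ x, ‖x‖ < r0 → glap N s φ x + μ * (φ x * ‖x‖ ^ (-(2*s))) ≤ K) ∧
        (∀ x, r0 ≤ ‖x‖ → glap N s φ x + μ * (φ x * ‖x‖ ^ (-(2*s))) ≤ 0) ∧
        ∀ x, 0 < ‖x‖ → ‖x‖ < r0/2 →
          φ x = hfun (ρ ^ (2*s)) (‖x‖ ^ σ - ρ ^ (σ - (2*s - N - σ)) * ‖x‖ ^ (2*s - N - σ)) := by
  have hN0 : (2:ℝ) ≤ N := by exact_mod_cast hN
  have hC := CNs_pos hN hs0 hs1
  let χ : ContDiffBump (0 : EN N) := ⟨r0/2, r0, by positivity, by linarith⟩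
  have hχ1 : ContDiff ℝ (⊤ : ℕ∞) χ := χ.contDiff
  have hχ2 : HasCompactSupport χ := χ.hasCompactSupport
  have hχin : ∀ x : EN N, ‖x‖ ≤ r0/2 → χ x = 1 := fun x hx =>
    χ.one_of_mem_closedBall (by simpa [χ] using hx)
  have hχout : ∀ x : EN N, r0 ≤ ‖x‖ → χ x = 0 := fun x hx =>
    χ.zero_of_le_dist (by simpa [χ] using hx)
  have hχle : ∀ x : EN N, χ x ≤ 1 := fun x => χ.le_one
  have hχge : ∀ x : EN N, 0 ≤ χ x := fun x => χ.nonneg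
  generalize (χ : EN N → ℝ) = X at hχ1 hχ2 hχin hχout hχle hχge
  obtain ⟨B, hB, hgB⟩ := glap_bound hN hs0 hs1 hχ1 hχ2
  set A := (r0 ^ τp + (2*r0) ^ τp) + (r0 ^ σb + (2*r0) ^ σb) with hA
  have hA0 : 0 < A := by positivity
  set H := 2 ^ ((N:ℝ) + 2*s) * ∫ z, tailT N r0 τp σb z / ‖z‖ ^ ((N:ℝ) + 2*s) with hH
  have hH0 : 0 ≤ H := mul_nonneg (by positivity) (integral_nonneg fun z =>
    div_nonneg (tailT_nonneg z) (by positivity))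
  refine ⟨|μ| * (1 + A * (r0/2) ^ (-(2*s))) + A * B + CNs N s * H, by positivity, ?_⟩
  intro σ ρ hσ1 hσ2 hσ3 hc hρ hρr
  set σ' := 2*s - N - σ with hσ'
  set δ := ρ ^ (σ - σ') with hδ
  have hδ0 : 0 < δ := by positivity
  set η := ρ ^ (2*s) with hη
  have hη0 : 0 < η := by positivity
  set v : EN N → ℝ := fun x => ‖x‖ ^ σ - δ * ‖x‖ ^ σ' - A * (1 - X x) with hv
  have hσσ' : 0 < σ - σ' := by rw [hσ']; linarith
  have hfac : ∀ x : EN N, 0 < ‖x‖ → ‖x‖ ^ σ = ‖x‖ ^ (σ - σ') * ‖x‖ ^ σ' := by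
    intro x hx; rw [← Real.rpow_add hx]; ring_nf
  have hv1 : ∀ x, 0 < ‖x‖ → ‖x‖ ≤ ρ → v x ≤ 0 := by
    intro x hx hxρ
    have h1 : ‖x‖ ^ (σ - σ') ≤ δ := Real.rpow_le_rpow hx.le hxρ hσσ'.le
    have h2 : 0 ≤ A * (1 - X x) := mul_nonneg hA0.le (by linarith [hχle x])
    have h3 : ‖x‖ ^ (σ - σ') * ‖x‖ ^ σ' ≤ δ * ‖x‖ ^ σ' := by gcongr
    simp only [hv]; rw [hfac x hx]; linarith
  have hv2 : ∀ x, r0 ≤ ‖x‖ → ‖x‖ ≤ 2*r0 → v x ≤ 0 := by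
    intro x hx hx2
    have hx0 : 0 < ‖x‖ := by linarith
    have h1 := rpow_le_sum hx0 hσ1 hσ2
    have h2 := rpow_le_ends (τ := τp) hr0 hx hx2
    have h3 := rpow_le_ends (τ := σb) hr0 hx hx2
    have h4 : 0 ≤ δ * ‖x‖ ^ σ' := by positivity
    simp only [hv]; rw [hχout x hx]; linarith
  have hvs : ∀ x, x ≠ 0 → ContDiffAt ℝ (⊤ : ℕ∞) v x := by
    intro x hx
    have hn : ContDiffAt ℝ (⊤ : ℕ∞) (fun x : EN N => ‖x‖) x := contDiffAt_norm ℝ hx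
    have hp : ∀ t : ℝ, ContDiffAt ℝ (⊤ : ℕ∞) (fun x : EN N => ‖x‖ ^ t) x := fun t =>
      hn.rpow_const_of_ne (norm_ne_zero_iff.2 hx)
    exact ((hp σ).sub (contDiffAt_const.mul (hp σ'))).sub
      (contDiffAt_const.mul (contDiffAt_const.sub hχ1.contDiffAt))
  set φ := tfun N ρ r0 η v with hφ
  have hφ1 : ContDiff ℝ (⊤ : ℕ∞) φ := tfun_contDiff hη0 hρ hρr hv1 hv2 hvs
  have hφ2 : HasCompactSupport φ := tfun_compact hη0 hρ hv1 hv2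
  have hφ0 : ∀ x, 0 ≤ φ x := tfun_nonneg hη0
  have hφz : ∀ x, φ x = 0 → glap N s φ x + μ * (φ x * ‖x‖ ^ (-(2*s))) ≤ 0 := by
    intro x hx
    have := glap_nonpos hN hs0 hs1 hφ0 x hx
    rw [hx]; simpa using this
  refine ⟨φ, hφ1, hφ2, tfun_tsupport hη0 hρ hv1 hv2, hφ0, ?_, ?_, ?_⟩
  · intro x hxr
    by_cases hx0 : φ x = 0
    · exact (hφz x hx0).trans (by positivity)
    have hxρ : ρ < ‖x‖ := by
      by_contra h
      exact hx0 (tfun_zero hη0 hρ hv1 hv2 x (Or.inl (not_lt.1 h)))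
    have hxp : 0 < ‖x‖ := by linarith
    have hφx : φ x = hfun η (v x) := tfun_eq hη0 hv1 x hxp (by linarith)
    have ht : 0 < v x := by
      by_contra h
      exact hx0 (by rw [hφx, hfun_nonpos hη0 (not_lt.1 h)])
    obtain ⟨p, e, hp0, hp1, he0, he1, hpe, htan⟩ := hfun_tangent hη0 ht
    rw [← hφx] at hpe htan
    have hle : ∀ z, z ≠ 0 → φ x - φ z ≤ p * ((‖x‖^σ - ‖z‖^σ) - δ * (‖x‖^σ' - ‖z‖^σ')
      + A * (X x - X z)) + tailT N r0 τp σb z := by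
      intro z hz
      have hzp : 0 < ‖z‖ := norm_pos_iff.2 hz
      have e1 : (‖x‖^σ - ‖z‖^σ) - δ * (‖x‖^σ' - ‖z‖^σ') + A * (X x - X z) = v x - v z := by
        simp only [hv]; ring
      rw [e1]
      by_cases hz2 : ‖z‖ < 2 * r0
      · have h1 : φ z = hfun η (v z) := tfun_eq hη0 hv1 z hzp hz2
        have h2 := htan (v z)
        have h3 := tailT_nonneg (r0 := r0) (τ := τp) (σb := σb) z
        rw [h1]; linarith
      · push Not at hz2
        have h1 : φ z = 0 := tfun_zero hη0 hρ hv1 hv2 z (Or.inr (by linarith))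
        have h2 : tailT N r0 τp σb z = ‖z‖^τp + ‖z‖^σb := by
          simp [tailT, indicator, hz2]
        have h3 := rpow_le_sum hzp hσ1 hσ2
        have h4 : v z ≤ tailT N r0 τp σb z := by
          have a1 : 0 ≤ δ * ‖z‖ ^ σ' := by positivity
          have a2 : 0 ≤ A * (1 - X z) := mul_nonneg hA0.le (by linarith [hχle z])
          rw [h2]; simp only [hv]; linarith
        have h5 := tailT_nonneg (r0 := r0) (τ := τp) (σb := σb) z
        have h6 : p * v z ≤ tailT N r0 τp σb z := by
          rcases le_or_gt (v z) 0 with h | h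
          · exact (mul_nonpos_of_nonneg_of_nonpos hp0 h).trans h5
          · nlinarith
        have h7 : 0 ≤ η * e := by positivity
        rw [h1, hpe]; linarith
    obtain ⟨ti1, ti2⟩ := tailT_int hN hs0 hr0 (by linarith : τp < 2*s) hσb x hxr
    have hcmp := glap_compare hN hs0 hs1 hφ1 hφ2 hχ1 hχ2 x (norm_pos_iff.1 hxp)
      (σ := σ) (σ' := σ') (by linarith) (by linarith) (by rw [hσ']; linarith)
      (by rw [hσ']; linarith) tailT_meas.aestronglyMeasurable
      (fun l hl => tailT_gauss hN (by linarith) (by linarith) x hl) ti1 hle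
    rw [hσ', csFun_symm, ← hσ'] at hcmp
    set Y := ‖x‖ ^ (-(2*s)) with hY
    have hY0 : 0 < Y := by positivity
    set W := ‖x‖^σ - δ * ‖x‖^σ' with hW
    have hWv : W = v x + A * (1 - X x) := by simp only [hv, hW]; ring
    have hX1 : 0 ≤ 1 - X x := by linarith [hχle x]
    have hW0 : 0 ≤ W := by rw [hWv]; positivity
    have hηY : η * Y ≤ 1 := by
      rw [hY, Real.rpow_neg hxp.le, ← div_eq_mul_inv, div_le_one (by positivity)]
      exact Real.rpow_le_rpow hρ.le hxρ.le (by positivity)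
    have hXY : (1 - X x) * Y ≤ (r0/2) ^ (-(2*s)) := by
      by_cases h : ‖x‖ ≤ r0/2
      · rw [hχin x h]; simp only [sub_self, zero_mul]; positivity
      · push Not at h
        have : Y ≤ (r0/2) ^ (-(2*s)) :=
          Real.rpow_le_rpow_of_nonpos (by positivity) h.le (by linarith)
        nlinarith [hχge x]
    have b1 : csFun N s σ * (p * W * Y) ≤ -μ * (p * W * Y) := by gcongr
    have b2 : p * (A * glap N s X x) ≤ A * B := by
      have : A * glap N s X x ≤ A * B := by
        gcongr; exact (le_abs_self _).trans (hgB x)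
      have h0 : 0 ≤ A * B := by positivity
      rcases le_or_gt (A * glap N s X x) 0 with h | h
      · exact (mul_nonpos_of_nonneg_of_nonpos hp0 h).trans h0
      · nlinarith
    have b3 : CNs N s * ∫ z, tailT N r0 τp σb z / ‖x - z‖ ^ ((N:ℝ) + 2*s) ≤ CNs N s * H := by
      gcongr
    have b4 : (p * W - φ x) * Y = e * (η * Y) + p * A * ((1 - X x) * Y) := by
      rw [hpe, hWv]; ring
    have b5 : 0 ≤ (p * W - φ x) * Y := by rw [b4]; positivity
    have b6 : (p * W - φ x) * Y ≤ 1 + A * (r0/2) ^ (-(2*s)) := by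
      rw [b4]
      have c1 : e * (η * Y) ≤ 1 * 1 := by gcongr
      have c2 : p * A * ((1 - X x) * Y) ≤ 1 * A * (r0/2) ^ (-(2*s)) := by gcongr
      linarith
    have b7 : -μ * ((p * W - φ x) * Y) ≤ |μ| * (1 + A * (r0/2) ^ (-(2*s))) := by
      have c1 : -μ * ((p * W - φ x) * Y) ≤ |μ| * ((p * W - φ x) * Y) := by
        gcongr; exact neg_le_abs μ
      refine c1.trans ?_
      gcongr
    have b8 : p * (csFun N s σ * (‖x‖ ^ σ * Y) - δ * (csFun N s σ * (‖x‖ ^ σ' * Y))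
        + A * glap N s X x) = csFun N s σ * (p * W * Y) + p * (A * glap N s X x) := by
      rw [hW]; ring
    rw [b8] at hcmp
    have b9 : -μ * ((p * W - φ x) * Y) = -μ * (p * W * Y) + μ * (φ x * Y) := by ring
    linarith
  · intro x hx
    exact hφz x (tfun_zero hη0 hρ hv1 hv2 x (Or.inr hx))
  · intro x hx hx2
    rw [hφ, tfun_eq hη0 hv1 x hx (by linarith)]
    simp only [hv]
    rw [hχin x hx2.le]
    simp

lemma gamma_ineq {p q e : ℝ} (he : 0 < e) (heq : e < q) (hqp : q < p) :
    Real.Gamma (p+e) * Real.Gamma (p-e) * (Real.Gamma q * Real.Gamma q) ≤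
      (Real.Gamma p * Real.Gamma p) * (Real.Gamma (q+e) * Real.Gamma (q-e)) := by
  have G := fun x => Real.GammaSeq_tendsto_Gamma x
  refine le_of_tendsto_of_tendsto (((G (p+e)).mul (G (p-e))).mul ((G q).mul (G q)))
    (((G p).mul (G p)).mul ((G (q+e)).mul (G (q-e)))) ?_
  filter_upwards [eventually_ge_atTop 1] with n hn
  have hn0 : (0:ℝ) < n := by exact_mod_cast hn
  unfold Real.GammaSeq
  have hpos : ∀ x : ℝ, 0 < x → 0 < ∏ j ∈ Finset.range (n+1), (x + j) := fun x hx =>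
    Finset.prod_pos fun j _ => by positivity
  have P1 := hpos (p+e) (by linarith)
  have P2 := hpos (p-e) (by linarith)
  have P3 := hpos q (by linarith)
  have P4 := hpos p (by linarith)
  have P5 := hpos (q+e) (by linarith)
  have P6 := hpos (q-e) (by linarith)
  have key : (∏ j ∈ Finset.range (n+1), (p + j)) * (∏ j ∈ Finset.range (n+1), (p + j)) *
      ((∏ j ∈ Finset.range (n+1), (q + e + j)) * (∏ j ∈ Finset.range (n+1), (q - e + j))) ≤
      (∏ j ∈ Finset.range (n+1), (p + e + j)) * (∏ j ∈ Finset.range (n+1), (p - e + j)) *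
      ((∏ j ∈ Finset.range (n+1), (q + j)) * (∏ j ∈ Finset.range (n+1), (q + j))) := by
    simp only [← Finset.prod_mul_distrib]
    refine Finset.prod_le_prod (fun j _ => ?_) fun j _ => ?_
    · have : (0:ℝ) ≤ j := Nat.cast_nonneg j
      have h1 : 0 < q - e := by linarith
      have h2 : 0 < q := by linarith
      have h3 : 0 < p := by linarith
      positivity
    · have : (0:ℝ) ≤ j := Nat.cast_nonneg j
      have h1 : (q + j)^2 ≤ (p + j)^2 := by gcongr; linarith
      nlinarith [mul_le_mul_of_nonneg_left h1 (sq_nonneg e)]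
  have e1 : (n:ℝ) ^ (p+e) * (n:ℝ) ^ (p-e) = (n:ℝ) ^ p * (n:ℝ) ^ p := by
    rw [← Real.rpow_add hn0, ← Real.rpow_add hn0]; ring_nf
  have e2 : (n:ℝ) ^ (q+e) * (n:ℝ) ^ (q-e) = (n:ℝ) ^ q * (n:ℝ) ^ q := by
    rw [← Real.rpow_add hn0, ← Real.rpow_add hn0]; ring_nf
  rw [div_mul_div_comm, div_mul_div_comm, div_mul_div_comm, div_mul_div_comm, div_mul_div_comm,
    div_mul_div_comm]
  refine div_le_div₀ ?_ (le_of_eq ?_) (by positivity) key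
  · positivity
  · linear_combination ((n.factorial:ℝ)^4 * (n:ℝ)^q * (n:ℝ)^q) * e1 -
      ((n.factorial:ℝ)^4 * (n:ℝ)^p * (n:ℝ)^p) * e2

lemma csFun_crit {N : ℕ} {s e : ℝ} (hs0 : 0 < s) (he : 0 < e)
    (heq : e < ((N:ℝ) - 2*s)/4) :
    csFun N s ((2*s - N)/2 + 2*e) ≤ csFun N s ((2*s - N)/2) := by
  unfold csFun
  rw [show ((N:ℝ) + ((2*s - N)/2 + 2*e))/2 = (N + 2*s)/4 + e by ring,
    show (2*s - ((2*s - N)/2 + 2*e))/2 = ((N:ℝ) + 2*s)/4 - e by ring,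
    show -((2*s - N)/2 + 2*e)/2 = ((N:ℝ) - 2*s)/4 - e by ring,
    show ((N:ℝ) - 2*s + ((2*s - N)/2 + 2*e))/2 = ((N:ℝ) - 2*s)/4 + e by ring,
    show ((N:ℝ) + ((2*s - N)/2))/2 = (N + 2*s)/4 by ring,
    show (2*s - ((2*s - N)/2))/2 = ((N:ℝ) + 2*s)/4 by ring,
    show -((2*s - N)/2)/2 = ((N:ℝ) - 2*s)/4 by ring,
    show ((N:ℝ) - 2*s + ((2*s - N)/2))/2 = ((N:ℝ) - 2*s)/4 by ring]
  have hq : 0 < ((N:ℝ) - 2*s)/4 := by linarith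
  have h := gamma_ineq he heq (show ((N:ℝ) - 2*s)/4 < ((N:ℝ) + 2*s)/4 by linarith)
  have g1 := Real.Gamma_pos_of_pos hq
  have g2 := Real.Gamma_pos_of_pos (show 0 < ((N:ℝ) - 2*s)/4 - e by linarith)
  have g3 := Real.Gamma_pos_of_pos (show 0 < ((N:ℝ) - 2*s)/4 + e by linarith)
  rw [div_le_div_iff₀ (by positivity) (by positivity)]
  have h2 : (0:ℝ) < 2 ^ (2*s) := by positivity
  nlinarith [mul_le_mul_of_nonneg_left h h2.le]

lemma sigma_seq {N : ℕ} (hN : 2 ≤ N) {s μ τp : ℝ} (hs0 : 0 < s) (hs1 : s < 1)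
    (hτp : τp ∈ Ico ((2*s - N)/2) (2*s)) (hτpc : csFun N s τp = -μ) :
    ∃ σb < 2*s, ∃ σ : ℕ → ℝ, Tendsto σ atTop (𝓝 τp) ∧ ∀ n, τp ≤ σ n ∧ σ n ≤ σb ∧
      (2*s - N)/2 < σ n ∧ csFun N s (σ n) ≤ -μ := by
  have hN0 : (2:ℝ) ≤ N := by exact_mod_cast hN
  rcases hτp.1.lt_or_eq with h | h
  · exact ⟨τp, hτp.2, fun _ => τp, tendsto_const_nhds, fun _ => ⟨le_rfl, le_rfl, h, hτpc.le⟩⟩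
  · set q := ((N:ℝ) - 2*s)/4 with hq
    have hq0 : 0 < q := by rw [hq]; linarith
    refine ⟨τp + q, by rw [← h, hq]; linarith, fun n => τp + 2 * ((q/2) * (1/((n:ℝ)+1))), ?_, ?_⟩
    · have := ((tendsto_one_div_add_atTop_nhds_zero_nat (𝕜 := ℝ)).const_mul (q/2)).const_mul 2
      simpa using this.const_add τp
    · intro n
      have h1 : 0 < 1 / ((n:ℝ)+1) := by positivity
      have h2 : 1 / ((n:ℝ)+1) ≤ 1 := by
        rw [div_le_one (by positivity)]; linarith [Nat.cast_nonneg (α := ℝ) n]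
      have h3 : 0 < q/2 * (1 / ((n:ℝ)+1)) := by positivity
      have h4 : q/2 * (1 / ((n:ℝ)+1)) ≤ q/2 := by nlinarith
      refine ⟨by linarith, by linarith, by linarith, ?_⟩
      rw [← hτpc, ← h]
      exact csFun_crit hs0 h3 (by linarith)

lemma holder_cont {N : ℕ} {θ : ℝ} (hθ : 0 < θ) {f : EN N → ℝ} {S K : Set (EN N)}
    (hf : HolderLocOn N θ f S) (hKS : K ⊆ S) (hK : IsCompact K) : ContinuousOn f K := by
  obtain ⟨C, hC⟩ := hf K hKS hK
  intro x hx
  rw [ContinuousWithinAt, tendsto_iff_dist_tendsto_zero]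
  have h1 : Tendsto (fun y => C * dist y x ^ θ) (𝓝[K] x) (𝓝 0) := by
    have hc : Continuous (fun y => C * dist y x ^ θ) :=
      continuous_const.mul ((continuous_id.dist continuous_const).rpow_const
        fun y => Or.inr hθ.le)
    have := hc.tendsto x
    simp only [dist_self, Real.zero_rpow hθ.ne', mul_zero] at this
    exact this.mono_left nhdsWithin_le_nhds
  refine squeeze_zero' (Eventually.of_forall fun y => dist_nonneg) ?_ h1
  filter_upwards [self_mem_nhdsWithin] with y hy
  rw [Real.dist_eq]
  exact hC y hy x hx

lemma rho_ex {ex r : ℝ} (hex : 0 < ex) (hr : 0 < r) (c : ℝ) (hc : 0 < c) :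
    ∃ ρ, 0 < ρ ∧ ρ < r ∧ ρ < c ∧ ρ ^ ex < c := by
  have h1 : Tendsto (fun ρ : ℝ => ρ ^ ex) (𝓝[>] 0) (𝓝 0) := by
    have := (Real.continuous_rpow_const hex.le).tendsto (0:ℝ)
    rw [Real.zero_rpow hex.ne'] at this
    exact this.mono_left nhdsWithin_le_nhds
  have h2 := h1.eventually (Iio_mem_nhds hc)
  have h3 : ∀ᶠ ρ in 𝓝[>] (0:ℝ), ρ < min r c :=
    mem_nhdsWithin_of_mem_nhds (Iio_mem_nhds (lt_min hr hc))
  have h4 : ∀ᶠ ρ in 𝓝[>] (0:ℝ), 0 < ρ := self_mem_nhdsWithin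
  obtain ⟨ρ, ha, hb, hp⟩ := (h2.and (h3.and h4)).exists
  exact ⟨ρ, hp, hb.trans_le (min_le_left _ _), hb.trans_le (min_le_right _ _), ha⟩

lemma hfun_tendsto {η t : ℕ → ℝ} {T : ℝ} (hT : 0 < T) (hη : ∀ n, 0 < η n)
    (h1 : Tendsto η atTop (𝓝 0)) (h2 : Tendsto t atTop (𝓝 T)) :
    Tendsto (fun n => hfun (η n) (t n)) atTop (𝓝 T) := by
  have h3 : Tendsto (fun n => t n * Real.exp (-(η n / t n))) atTop (𝓝 T) := by
    have := h2.mul (Real.continuous_exp.tendsto _ |>.comp (h1.div h2 hT.ne').neg)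
    simpa using this
  refine h3.congr' ?_
  filter_upwards [h2.eventually (Ioi_mem_nhds hT)] with n hn
  rw [hfun_pos (hη n) hn]

lemma energy_bound {N : ℕ} (hN : 2 ≤ N) {s μ r0 ρ K : ℝ} (hs0 : 0 < s) (hs1 : s < 1)
    (hρ : 0 < ρ) (hr0 : 0 < r0) (hK : 0 ≤ K) {Ω : Set (EN N)} {f u φ : EN N → ℝ}
    (hΩ : closedBall (0:EN N) r0 ⊆ Ω)
    (hu : MemL1w N s u) (hu0 : ∀ x, 0 ≤ u x) (hD : DistrEq N s μ Ω f u)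
    (h1 : ContDiff ℝ (⊤ : ℕ∞) φ) (h2 : HasCompactSupport φ)
    (h3 : tsupport φ ⊆ {x | ρ ≤ ‖x‖ ∧ ‖x‖ ≤ r0})
    (h5 : ∀ x, ‖x‖ < r0 → glap N s φ x + μ * (φ x * ‖x‖ ^ (-(2*s))) ≤ K)
    (h6 : ∀ x, r0 ≤ ‖x‖ → glap N s φ x + μ * (φ x * ‖x‖ ^ (-(2*s))) ≤ 0) :
    ∫ x in Ω, f x * φ x ≤
      K * (1 + r0 ^ ((N:ℝ) + 2*s)) * ∫ x, u x / (1 + ‖x‖ ^ ((N:ℝ) + 2*s)) := by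
  have hsup : tsupport φ ⊆ Ω \ {0} := by
    intro x hx
    have := h3 hx
    refine ⟨hΩ (by simpa using this.2), ?_⟩
    rintro rfl
    have := this.1
    simp at this; linarith
  have hE := hD φ h1 h2 hsup (glap N s φ) (glap_hasFracLap hN hs0 hs1 h1 h2)
  obtain ⟨hum, hi1⟩ := glap_int hN hs0 hs1 h1 h2 hu
  obtain ⟨M, hM, hbM, -⟩ := sdiff2_bound h1 h2
  set P := (N:ℝ) + 2*s with hP
  have hP0 : 0 < P := by positivity
  have hi2 : Integrable (fun x => u x * φ x / ‖x‖ ^ (2*s)) := by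
    have hc := h1.continuous
    refine (hu.const_mul (M / ρ ^ (2*s) * (1 + r0 ^ P))).mono' ?_
      (Eventually.of_forall fun x => ?_)
    · have hm : AEStronglyMeasurable (fun x : EN N => φ x / ‖x‖ ^ (2*s)) :=
        Measurable.aestronglyMeasurable (by have := hc.measurable; fun_prop)
      refine (hum.mul hm).congr (Eventually.of_forall fun x => ?_)
      simp only [Pi.mul_apply]; ring
    · by_cases hx : φ x = 0
      · rw [hx, mul_zero, zero_div, norm_zero]
        have := hu0 x
        positivity
      · have hx' := h3 (subset_tsupport φ hx)
        have hx1 : ρ ≤ ‖x‖ := hx'.1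
        have hx2 : ‖x‖ ≤ r0 := hx'.2
        have := hu0 x
        rw [norm_div, norm_mul, Real.norm_of_nonneg this, Real.norm_of_nonneg (by positivity : (0:ℝ) ≤ ‖x‖ ^ (2*s)), Real.norm_eq_abs]
        have a1 : u x * |φ x| / ‖x‖ ^ (2*s) ≤ u x * M / ρ ^ (2*s) := by
          gcongr
          exact hbM x
        refine a1.trans ?_
        have a2 : 1 + ‖x‖ ^ P ≤ 1 + r0 ^ P := by gcongr
        have a3 : 1 ≤ (1 + r0 ^ P) / (1 + ‖x‖ ^ P) := by
          rw [one_le_div (by positivity)]; exact a2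
        calc u x * M / ρ ^ (2*s) = u x * M / ρ ^ (2*s) * 1 := by ring
          _ ≤ u x * M / ρ ^ (2*s) * ((1 + r0 ^ P) / (1 + ‖x‖ ^ P)) := by gcongr
          _ = _ := by ring
  rw [← hE, ← integral_const_mul, ← integral_const_mul, ← integral_add hi1 (hi2.const_mul μ)]
  refine integral_mono (hi1.add (hi2.const_mul μ)) (hu.const_mul _) fun x => ?_
  have e1 : u x * glap N s φ x + μ * (u x * φ x / ‖x‖ ^ (2*s)) =
      u x * (glap N s φ x + μ * (φ x * ‖x‖ ^ (-(2*s)))) := by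
    rw [Real.rpow_neg (norm_nonneg x)]; ring
  simp only
  rw [e1]
  have hux := hu0 x
  by_cases hx : ‖x‖ < r0
  · have a2 : 1 + ‖x‖ ^ P ≤ 1 + r0 ^ P := by gcongr
    have a3 : 1 ≤ (1 + r0 ^ P) / (1 + ‖x‖ ^ P) := by
      rw [one_le_div (by positivity)]; exact a2
    calc _ ≤ u x * K := by gcongr; exact h5 x hx
      _ = u x * K * 1 := by ring
      _ ≤ u x * K * ((1 + r0 ^ P) / (1 + ‖x‖ ^ P)) := by gcongr
      _ = _ := by ring
  · have := mul_nonpos_of_nonneg_of_nonpos hux (h6 x (not_lt.1 hx))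
    refine this.trans (by positivity)

set_option maxHeartbeats 1000000 in
lemma main_aux
    (N : ℕ) (hN : 2 ≤ N) (s : ℝ) (hs : s ∈ Ioo (0:ℝ) 1)
    (μ τp : ℝ)
    (hτp : τp ∈ Ico ((2*s - N)/2) (2*s)) (hτpc : csFun N s τp = -μ)
    (Ω : Set (EN N)) (hΩo : IsOpen Ω) (hΩb : Bornology.IsBounded Ω) (h0 : (0:EN N) ∈ Ω)
    (θ : ℝ) (hθ : θ ∈ Ioo (0:ℝ) 1)
    (f : EN N → ℝ) (hf : HolderLocOn N θ f (closure Ω \ {0}))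
    (hfpos : ∀ x ∈ Ω, 0 ≤ f x)
    (u : EN N → ℝ) (hu : MemL1w N s u) (hu0 : ∀ x, 0 ≤ u x) (hD : DistrEq N s μ Ω f u) :
    ∫⁻ x in Ω, ENNReal.ofReal (f x * ‖x‖ ^ τp) ≠ ⊤ := by
  obtain ⟨hs0, hs1⟩ := hs
  obtain ⟨σb, hσb, σ, hσt, hσ⟩ := sigma_seq hN hs0 hs1 hτp hτpc
  obtain ⟨r0, hr0, hrΩ⟩ : ∃ r0 > 0, closedBall (0:EN N) r0 ⊆ Ω :=
    Metric.nhds_basis_closedBall.mem_iff.1 (hΩo.mem_nhds h0)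
  obtain ⟨K, hK, hT⟩ := test_fn (μ := μ) hN hs0 hs1 hτp.1 hσb hr0
  have hρex : ∀ n : ℕ, ∃ ρ, 0 < ρ ∧ ρ < r0 ∧ ρ < 1/((n:ℝ)+1) ∧
      ρ ^ (σ n - (2*s - N - σ n)) < 1/((n:ℝ)+1) := fun n =>
    rho_ex (by linarith [(hσ n).2.2.1]) hr0 _ (by positivity)
  choose ρ hρ0 hρr hρ1 hρ2 using hρex
  have hφex := fun n => hT (σ n) (ρ n) (hσ n).1 (hσ n).2.1 (hσ n).2.2.1 (hσ n).2.2.2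
    (hρ0 n) (hρr n)
  choose φ hφ1 hφ2 hφ3 hφ4 hφ5 hφ6 hφ7 using hφex
  set KK := K * (1 + r0 ^ ((N:ℝ) + 2*s)) * ∫ x, u x / (1 + ‖x‖ ^ ((N:ℝ) + 2*s)) with hKK
  have hbd : ∀ n, ∫ x in Ω, f x * φ n x ≤ KK := fun n =>
    energy_bound hN hs0 hs1 (hρ0 n) hr0 hK hrΩ hu hu0 hD (hφ1 n) (hφ2 n) (hφ3 n) (hφ5 n) (hφ6 n)
  have hInteg : ∀ n, Integrable (fun x => f x * φ n x) := by
    intro n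
    have hSc : IsCompact (tsupport (φ n)) := hφ2 n
    have hcont : ContinuousOn f (tsupport (φ n)) := by
      refine holder_cont hθ.1 hf (fun x hx => ?_) hSc
      have h := hφ3 n hx
      refine ⟨subset_closure (hrΩ (by simpa using h.2)), ?_⟩
      rintro rfl
      have := h.1
      simp at this; linarith [hρ0 n]
    have : IntegrableOn (fun x => f x * φ n x) (tsupport (φ n)) :=
      (hcont.mul (hφ1 n).continuous.continuousOn).integrableOn_compact hSc
    rwa [integrableOn_iff_integrable_of_support_subset] at this
    intro x hx
    refine subset_tsupport _ (fun h => hx ?_)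
    simp [h]
  have hlin : ∀ n, ∫⁻ x in Ω, ENNReal.ofReal (f x * φ n x) ≤ ENNReal.ofReal KK := by
    intro n
    rw [← ofReal_integral_eq_lintegral_ofReal (hInteg n).integrableOn]
    · exact ENNReal.ofReal_le_ofReal (hbd n)
    · filter_upwards [ae_restrict_mem hΩo.measurableSet] with x hx
      exact mul_nonneg (hfpos x hx) (hφ4 n x)
  set U := ball (0:EN N) (r0/2) with hU
  have hUΩ : U ⊆ Ω := fun x hx => hrΩ (by
    have : ‖x‖ < r0/2 := by simpa [hU] using hx
    simp; linarith)
  have hρt : Tendsto ρ atTop (𝓝 0) :=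
    squeeze_zero (fun n => (hρ0 n).le) (fun n => (hρ1 n).le) tendsto_one_div_add_atTop_nhds_zero_nat
  have hδt : Tendsto (fun n => ρ n ^ (σ n - (2*s - N - σ n))) atTop (𝓝 0) :=
    squeeze_zero (fun n => (Real.rpow_pos_of_pos (hρ0 n) _).le) (fun n => (hρ2 n).le)
      tendsto_one_div_add_atTop_nhds_zero_nat
  have hηt : Tendsto (fun n => ρ n ^ (2*s)) atTop (𝓝 0) := by
    have := ((Real.continuous_rpow_const (show 0 ≤ 2*s by positivity)).tendsto (0:ℝ)).comp hρt
    rwa [Real.zero_rpow (by positivity)] at this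
  have hpt : ∀ x : EN N, x ≠ 0 → x ∈ U → Tendsto (fun n => φ n x) atTop (𝓝 (‖x‖ ^ τp)) := by
    intro x hx hxU
    have hxp : 0 < ‖x‖ := norm_pos_iff.2 hx
    have hx2 : ‖x‖ < r0/2 := by simpa [hU] using hxU
    have hc : Continuous (fun t : ℝ => ‖x‖ ^ t) := Real.continuous_const_rpow hxp.ne'
    have t1 : Tendsto (fun n => ‖x‖ ^ (σ n)) atTop (𝓝 (‖x‖ ^ τp)) := (hc.tendsto _).comp hσt
    have t2 : Tendsto (fun n => ‖x‖ ^ (2*s - N - σ n)) atTop (𝓝 (‖x‖ ^ (2*s - N - τp))) :=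
      (hc.tendsto _).comp (tendsto_const_nhds.sub hσt)
    have t3 := t1.sub (hδt.mul t2)
    rw [zero_mul, sub_zero] at t3
    have t4 := hfun_tendsto (Real.rpow_pos_of_pos hxp τp)
      (fun n => Real.rpow_pos_of_pos (hρ0 n) (2*s)) hηt t3
    refine t4.congr fun n => ?_
    rw [hφ7 n x hxp hx2]
  have hpart1 : ∫⁻ x in U, ENNReal.ofReal (f x * ‖x‖ ^ τp) ≤ ENNReal.ofReal KK := by
    have e1 : ∫⁻ x in U, ENNReal.ofReal (f x * ‖x‖ ^ τp) =
        ∫⁻ x in U, liminf (fun n => ENNReal.ofReal (f x * φ n x)) atTop := by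
      refine lintegral_congr_ae ?_
      filter_upwards [ae_restrict_mem measurableSet_ball, ae_restrict_of_ae (ae_ne hN 0)]
        with x hxU hx0
      have := (ENNReal.tendsto_ofReal ((hpt x hx0 hxU).const_mul (f x))).liminf_eq
      exact this.symm
    rw [e1]
    refine (lintegral_liminf_le' fun n =>
      ((hInteg n).aestronglyMeasurable.aemeasurable.ennreal_ofReal).restrict).trans ?_
    refine liminf_le_of_le (by isBoundedDefault) fun b hb => ?_
    obtain ⟨n, hn⟩ := hb.exists
    exact hn.trans ((lintegral_mono_set hUΩ).trans (hlin n))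
  have hpart2 : ∫⁻ x in Ω \ U, ENNReal.ofReal (f x * ‖x‖ ^ τp) < ⊤ := by
    have hKc : IsCompact (closure Ω \ U) :=
      (hΩb.isCompact_closure).diff isOpen_ball
    have hsub : closure Ω \ U ⊆ closure Ω \ {0} := by
      intro x hx
      refine ⟨hx.1, ?_⟩
      rintro rfl
      exact hx.2 (mem_ball_self (by positivity))
    have hcf := holder_cont hθ.1 hf hsub hKc
    have hcn : ContinuousOn (fun x : EN N => ‖x‖ ^ τp) (closure Ω \ U) := by
      refine continuous_norm.continuousOn.rpow_const fun x hx => Or.inl ?_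
      exact norm_ne_zero_iff.2 (hsub hx).2
    obtain ⟨C, hC⟩ := hKc.exists_bound_of_continuousOn (hcf.mul hcn)
    have hm : MeasurableSet (Ω \ U) := hΩo.measurableSet.diff measurableSet_ball
    calc _ ≤ ∫⁻ x in Ω \ U, ENNReal.ofReal C := by
          refine setLIntegral_mono' hm fun x hx => ENNReal.ofReal_le_ofReal ?_
          exact (le_abs_self _).trans (hC x ⟨subset_closure hx.1, hx.2⟩)
      _ = ENNReal.ofReal C * volume (Ω \ U) := setLIntegral_const _ _
      _ < ⊤ := ENNReal.mul_lt_top ENNReal.ofReal_lt_top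
          ((measure_mono diff_subset).trans_lt hΩb.measure_lt_top)
  have hsplit : ∫⁻ x in Ω, ENNReal.ofReal (f x * ‖x‖ ^ τp) ≤
      (∫⁻ x in U, ENNReal.ofReal (f x * ‖x‖ ^ τp)) +
        ∫⁻ x in Ω \ U, ENNReal.ofReal (f x * ‖x‖ ^ τp) := by
    refine (lintegral_mono_set ?_).trans (lintegral_union_le _ U (Ω \ U))
    intro x hx
    by_cases h : x ∈ U
    · exact Or.inl h
    · exact Or.inr ⟨hx, h⟩
  exact (hsplit.trans_lt (ENNReal.add_lt_top.2
    ⟨hpart1.trans_lt ENNReal.ofReal_lt_top, hpart2⟩)).ne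

/-- Theorem C(iii): nonexistence of nonnegative distributional solutions
when `f ≥ 0` satisfies `∫_Ω f Γ_μ dx = +∞`. -/
theorem nonexistence_non_integrable_source
    (N : ℕ) (hN : 2 ≤ N) (s : ℝ) (hs : s ∈ Ioo (0:ℝ) 1)
    (μ τp : ℝ) (hμ : mu0 N s ≤ μ)
    (hτp : τp ∈ Ico ((2*s - N)/2) (2*s)) (hτpc : csFun N s τp = -μ)
    (Ω : Set (EN N)) (hΩ : IsBoundedC2Domain N Ω) (h0 : (0:EN N) ∈ Ω)
    (θ : ℝ) (hθ : θ ∈ Ioo (0:ℝ) 1)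
    (f : EN N → ℝ) (hf : HolderLocOn N θ f (closure Ω \ {0}))
    (hfpos : ∀ x ∈ Ω, 0 ≤ f x)
    (hfinf : ∫⁻ x in Ω, ENNReal.ofReal (f x * ‖x‖ ^ τp) = ⊤) :
    ¬ ∃ u : EN N → ℝ, LocBddAway N u ∧ MemL1w N s u ∧ (∀ x, 0 ≤ u x) ∧
        DistrEq N s μ Ω f u := by
  rintro ⟨u, -, hu, hu0, hD⟩
  exact main_aux N hN s hs μ τp hτp hτpc Ω hΩ.isOpen hΩ.isBounded h0 θ hθ f hf hfpos u hu hu0 hD hfinf
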